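/- arXiv:0909.2607 — 2 statements merged into one kernel-verified Lean document; each statement's English description precedes it below -/
import Mathlib

section
/- Let d ≥ 1, n₁,…,n_d ≥ 1, n = n₁+…+n_d. There exist constants C₁, C₂ > 0, depending only on n₁,…,n_d, such that for every measurable set E ⊂ ℝⁿ with 0 < |E| < ∞ and every δ > 0 there exists a measurable function τ : ℝⁿ → [0,1] with: τ = 1 almost everywhere on E; ‖τ‖_bmo ≤ C₁δ; and |{x : τ(x) > 0}| ≤ C₂ e^{2/δ} |E|. -/
open MeasureTheory ENNReal Filter

noncomputable section

/-- A dyadic cube in `ℝ^m`, recorded by its generation `k` and its corner index `j`;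
it represents the set `∏ i, [j i * 2^k, (j i + 1) * 2^k)`. -/
structure DyadicCube (m : ℕ) where
  k : ℤ
  j : Fin m → ℤ

/-- The underlying set of a dyadic cube. -/
def dyadicCubeSet {m : ℕ} (c : DyadicCube m) : Set (Fin m → ℝ) :=
  {x | ∀ i, (c.j i : ℝ) * 2 ^ c.k ≤ x i ∧ x i < ((c.j i : ℝ) + 1) * 2 ^ c.k}

/-- The generation-`k` dyadic cube containing the point `x`. -/
def dyadicCubeOf {m : ℕ} (k : ℤ) (x : Fin m → ℝ) : DyadicCube m :=
  ⟨k, fun i => ⌊x i / 2 ^ k⌋⟩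

/-- `E_k f x`: the average of `f` over the generation-`k` dyadic cube containing `x`. -/
def Ek {m : ℕ} (k : ℤ) (f : (Fin m → ℝ) → ℝ) (x : Fin m → ℝ) : ℝ :=
  ⨍ y in dyadicCubeSet (dyadicCubeOf k x), f y

/-- The martingale difference operator `Δ_Q f = (E_{k-1} f - E_k f) · 1_Q`
for a dyadic cube `Q` of generation `k`. -/
def deltaQ {m : ℕ} (c : DyadicCube m) (f : (Fin m → ℝ) → ℝ) : (Fin m → ℝ) → ℝ :=
  (dyadicCubeSet c).indicator (fun y => Ek (c.k - 1) f y - Ek c.k f y)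

/-- The product space `ℝ^{n 0} × ⋯ × ℝ^{n (d-1)}`. -/
abbrev ProductSpace {d : ℕ} (n : Fin d → ℕ) : Type := ∀ i, (Fin (n i) → ℝ)

/-- A dyadic rectangle `R = Q₁ × ⋯ × Q_d`, one dyadic cube in each block. -/
abbrev DyadicRect {d : ℕ} (n : Fin d → ℕ) : Type := ∀ i, DyadicCube (n i)

/-- The underlying set of a dyadic rectangle. -/
def dyadicRectSet {d : ℕ} {n : Fin d → ℕ} (R : DyadicRect n) : Set (ProductSpace n) :=
  {x | ∀ i, x i ∈ dyadicCubeSet (R i)}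

/-- Apply the one-parameter operator `Δ_Q` in the `i`-th block of variables. -/
def deltaBlock {d : ℕ} {n : Fin d → ℕ} (i : Fin d) (c : DyadicCube (n i))
    (f : ProductSpace n → ℝ) (x : ProductSpace n) : ℝ :=
  deltaQ c (fun y => f (Function.update x i y)) (x i)

/-- The multiparameter difference operator `Δ_R = Δ_{Q₁} ⊗ ⋯ ⊗ Δ_{Q_d}`, obtained
by applying `Δ_{Q_i}` in the `i`-th block of variables. -/
def deltaR {d : ℕ} {n : Fin d → ℕ} (R : DyadicRect n) (f : ProductSpace n → ℝ) :
    ProductSpace n → ℝ :=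
  (List.finRange d).foldr (fun i g => deltaBlock i (R i) g) f

/-- The squared `L²` norm `‖g‖_{L²}²`, as an extended nonnegative real. -/
def l2normSq {d : ℕ} {n : Fin d → ℕ} (g : ProductSpace n → ℝ) : ℝ≥0∞ :=
  ∫⁻ x, ENNReal.ofReal (g x ^ 2)

/-- The multiparameter dyadic square function `S f (x) = (∑_R |Δ_R f(x)|²)^{1/2}`. -/
def squareFn {d : ℕ} {n : Fin d → ℕ} (f : ProductSpace n → ℝ) (x : ProductSpace n) : ℝ≥0∞ :=
  (∑' R : DyadicRect n, ENNReal.ofReal (deltaR R f x ^ 2)) ^ (1 / 2 : ℝ)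

/-- The dyadic product `H¹` norm `‖S f‖_{L¹}`. -/
def H1Norm {d : ℕ} {n : Fin d → ℕ} (f : ProductSpace n → ℝ) : ℝ≥0∞ :=
  ∫⁻ x, squareFn f x

/-- An axis-parallel cube in `ℝ^m` with arbitrary corner and (positive) side length. -/
structure Cube (m : ℕ) where
  corner : Fin m → ℝ
  side : ℝ
  side_pos : 0 < side

/-- The underlying set of a cube. -/
def cubeSet {m : ℕ} (c : Cube m) : Set (Fin m → ℝ) :=
  {x | ∀ i, c.corner i ≤ x i ∧ x i < c.corner i + c.side}

/-- A rectangle `R = Q₁ × ⋯ × Q_d`: an axis-parallel cube in each block. -/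
abbrev Rect {d : ℕ} (n : Fin d → ℕ) : Type := ∀ i, Cube (n i)

/-- The underlying set of a rectangle. -/
def rectSet {d : ℕ} {n : Fin d → ℕ} (R : Rect n) : Set (ProductSpace n) :=
  {x | ∀ i, x i ∈ cubeSet (R i)}

/-- The little `bmo` norm: `sup_R |R|⁻¹ ∫_R |f - f_R|` over all rectangles. -/
def bmo1 {d : ℕ} {n : Fin d → ℕ} (f : ProductSpace n → ℝ) : ℝ≥0∞ :=
  ⨆ R : Rect n,
    (volume (rectSet R))⁻¹ * ∫⁻ x in rectSet R, ENNReal.ofReal |f x - ⨍ y in rectSet R, f y|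

/-- The `L²`-based little `bmo` norm: `sup_R (|R|⁻¹ ∫_R |f - f_R|²)^{1/2}` over all
rectangles. -/
def bmo2 {d : ℕ} {n : Fin d → ℕ} (f : ProductSpace n → ℝ) : ℝ≥0∞ :=
  ⨆ R : Rect n,
    ((volume (rectSet R))⁻¹ *
      ∫⁻ x in rectSet R, ENNReal.ofReal ((f x - ⨍ y in rectSet R, f y) ^ 2)) ^ (1 / 2 : ℝ)

/-- The one-parameter `BMO` norm over all axis-parallel cubes in `ℝ^m`. -/
def bmo1Cube {m : ℕ} (g : (Fin m → ℝ) → ℝ) : ℝ≥0∞ :=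
  ⨆ Q : Cube m,
    (volume (cubeSet Q))⁻¹ * ∫⁻ x in cubeSet Q, ENNReal.ofReal |g x - ⨍ y in cubeSet Q, g y|

/-- The `L²`-based one-parameter `BMO` norm over all axis-parallel cubes in `ℝ^m`. -/
def bmo2Cube {m : ℕ} (g : (Fin m → ℝ) → ℝ) : ℝ≥0∞ :=
  ⨆ Q : Cube m,
    ((volume (cubeSet Q))⁻¹ *
      ∫⁻ x in cubeSet Q, ENNReal.ofReal ((g x - ⨍ y in cubeSet Q, g y) ^ 2)) ^ (1 / 2 : ℝ)

/-- The strong maximal function: supremum of averages of `|f|` over all rectangles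
containing the point. -/
def strongMaximal {d : ℕ} {n : Fin d → ℕ} (f : ProductSpace n → ℝ) (x : ProductSpace n) :
    ℝ≥0∞ :=
  ⨆ (R : Rect n) (_ : x ∈ rectSet R),
    (volume (rectSet R))⁻¹ * ∫⁻ y in rectSet R, ENNReal.ofReal |f y|

end
noncomputable section

/-- The centred maximal function over cubes (sup-norm balls) with dyadic radii. -/
def cubeMaximal {m : ℕ} (f : (Fin m → ℝ) → ℝ≥0∞) (x : Fin m → ℝ) : ℝ≥0∞ :=
  ⨆ k : ℤ, (volume (Metric.closedBall x ((2 : ℝ) ^ k)))⁻¹ *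
    ∫⁻ y in Metric.closedBall x ((2 : ℝ) ^ k), f y

/-- The maximal function `cubeMaximal` acting in the `i`-th block of variables. -/
def blockMaximal {d : ℕ} {n : Fin d → ℕ} (i : Fin d) (f : ProductSpace n → ℝ≥0∞)
    (x : ProductSpace n) : ℝ≥0∞ :=
  cubeMaximal (fun y => f (Function.update x i y)) (x i)

/-- The composition of the block maximal functions along a list of blocks. -/
def iterMaximal {d : ℕ} {n : Fin d → ℕ} (l : List (Fin d)) (f : ProductSpace n → ℝ≥0∞) :
    ProductSpace n → ℝ≥0∞ :=
  l.foldr blockMaximal f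

end

section CubeMaximal

variable {m : ℕ}

lemma volume_closedBall_two_zpow (x : Fin m → ℝ) (k : ℤ) :
    volume (Metric.closedBall x ((2 : ℝ) ^ k)) = ENNReal.ofReal ((2 * 2 ^ k) ^ m) := by
  rw [Real.volume_pi_closedBall _ (by positivity), Fintype.card_fin]

lemma volume_closedBall_two_zpow_ne_zero (x : Fin m → ℝ) (k : ℤ) :
    volume (Metric.closedBall x ((2 : ℝ) ^ k)) ≠ 0 := by
  rw [volume_closedBall_two_zpow, Ne, ENNReal.ofReal_eq_zero, not_le]
  positivity

lemma volume_closedBall_two_zpow_ne_top (x : Fin m → ℝ) (k : ℤ) :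
    volume (Metric.closedBall x ((2 : ℝ) ^ k)) ≠ ⊤ := by
  rw [volume_closedBall_two_zpow]
  exact ENNReal.ofReal_ne_top

lemma measurable_cubeMaximal_prod {α : Type*} [MeasurableSpace α]
    {g : α → (Fin m → ℝ) → ℝ≥0∞} (hg : Measurable (Function.uncurry g))
    {p : α → Fin m → ℝ} (hp : Measurable p) :
    Measurable fun a => cubeMaximal (g a) (p a) := by
  unfold cubeMaximal
  refine Measurable.iSup fun k => ?_
  simp_rw [volume_closedBall_two_zpow]
  refine Measurable.const_mul ?_ _
  simp_rw [← lintegral_indicator Metric.isClosed_closedBall.measurableSet]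
  refine Measurable.lintegral_prod_right
    (f := fun a y => (Metric.closedBall (p a) ((2 : ℝ) ^ k)).indicator (g a) y) ?_
  have hs : MeasurableSet {z : α × (Fin m → ℝ) | dist z.2 (p z.1) ≤ (2 : ℝ) ^ k} :=
    measurableSet_le (measurable_snd.dist (hp.comp measurable_fst)) measurable_const
  convert! hg.indicator hs using 1

lemma cubeMaximal_const_mul (c : ℝ≥0∞) {f : (Fin m → ℝ) → ℝ≥0∞} (hf : Measurable f)
    (x : Fin m → ℝ) : cubeMaximal (fun y => c * f y) x = c * cubeMaximal f x := by
  unfold cubeMaximal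
  rw [ENNReal.mul_iSup]
  refine iSup_congr fun k => ?_
  rw [lintegral_const_mul _ hf]
  ring

lemma cubeMaximal_mono {f g : (Fin m → ℝ) → ℝ≥0∞} (h : f ≤ g) (x : Fin m → ℝ) :
    cubeMaximal f x ≤ cubeMaximal g x :=
  iSup_mono fun _ => by gcongr; exact h _

lemma cubeMaximal_tsum_le {f : ℕ → (Fin m → ℝ) → ℝ≥0∞} (hf : ∀ j, Measurable (f j))
    (x : Fin m → ℝ) :
    cubeMaximal (fun y => ∑' j, f j y) x ≤ ∑' j, cubeMaximal (f j) x := by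
  refine iSup_le fun k => ?_
  rw [lintegral_tsum fun j => (hf j).aemeasurable, ← ENNReal.tsum_mul_left]
  exact ENNReal.tsum_le_tsum fun j =>
    le_iSup (fun k : ℤ => (volume (Metric.closedBall x ((2 : ℝ) ^ k)))⁻¹ *
      ∫⁻ y in Metric.closedBall x ((2 : ℝ) ^ k), f j y) k

lemma cubeMaximal_add_const_le {f g : (Fin m → ℝ) → ℝ≥0∞} (hf : Measurable f) (c : ℝ≥0∞)
    (h : ∀ y, g y ≤ f y + c) (x : Fin m → ℝ) : cubeMaximal g x ≤ cubeMaximal f x + c := by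
  refine iSup_le fun k => ?_
  calc _ ≤ (volume (Metric.closedBall x ((2 : ℝ) ^ k)))⁻¹ *
        ∫⁻ y in Metric.closedBall x ((2 : ℝ) ^ k), (f y + c) := by gcongr; exact h _
    _ = (volume (Metric.closedBall x ((2 : ℝ) ^ k)))⁻¹ *
        (∫⁻ y in Metric.closedBall x ((2 : ℝ) ^ k), f y) + c := by
      rw [lintegral_add_left hf, setLIntegral_const, mul_add, mul_comm c, ← mul_assoc,
        ENNReal.inv_mul_cancel (volume_closedBall_two_zpow_ne_zero x k)
          (volume_closedBall_two_zpow_ne_top x k), one_mul]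
    _ ≤ _ := by
      gcongr
      exact le_iSup (fun k : ℤ => (volume (Metric.closedBall x ((2 : ℝ) ^ k)))⁻¹ *
        ∫⁻ y in Metric.closedBall x ((2 : ℝ) ^ k), f y) k

lemma volume_le_of_forall_exists_average_gt {g : (Fin m → ℝ) → ℝ≥0∞} {t : ℝ≥0∞} (ht : t ≠ 0)
    (ht' : t ≠ ⊤) (K : ℕ) :
    volume {x : Fin m → ℝ | ∃ k : ℤ, k ≤ K ∧
      t < (volume (Metric.closedBall x ((2 : ℝ) ^ k)))⁻¹ *
        ∫⁻ y in Metric.closedBall x ((2 : ℝ) ^ k), g y} ≤ 5 ^ m * (t⁻¹ * ∫⁻ y, g y) := by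
  set S := {x : Fin m → ℝ | ∃ k : ℤ, k ≤ K ∧
      t < (volume (Metric.closedBall x ((2 : ℝ) ^ k)))⁻¹ *
        ∫⁻ y in Metric.closedBall x ((2 : ℝ) ^ k), g y} with hS
  have hk : ∀ x : Fin m → ℝ, ∃ k : ℤ, x ∈ S → k ≤ K ∧
      t < (volume (Metric.closedBall x ((2 : ℝ) ^ k)))⁻¹ *
        ∫⁻ y in Metric.closedBall x ((2 : ℝ) ^ k), g y := by
    intro x
    by_cases hx : x ∈ S
    · obtain ⟨k, hk⟩ := hx
      exact ⟨k, fun _ => hk⟩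
    · exact ⟨0, fun h => absurd h hx⟩
  choose k hk using hk
  obtain ⟨u, huS, hdisj, hcov⟩ :=
    Vitali.exists_disjoint_subfamily_covering_enlargement_closedBall S (fun x => x)
      (fun x => (2 : ℝ) ^ k x) ((2 : ℝ) ^ (K : ℤ))
      (fun x hx => zpow_le_zpow_right₀ (by norm_num) (hk x hx).1) 5 (by norm_num)
  have hu : u.Countable := hdisj.countable_of_nonempty_interior fun x _ =>
    ⟨x, Metric.ball_subset_interior_closedBall (Metric.mem_ball_self (by positivity))⟩
  have : Countable u := hu.to_subtype
  have hball : ∀ x ∈ S, volume (Metric.closedBall x (5 * (2 : ℝ) ^ k x)) ≤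
      5 ^ m * (t⁻¹ * ∫⁻ y in Metric.closedBall x ((2 : ℝ) ^ k x), g y) := by
    intro x hx
    have h1 : volume (Metric.closedBall x (5 * (2 : ℝ) ^ k x)) =
        5 ^ m * volume (Metric.closedBall x ((2 : ℝ) ^ k x)) := by
      rw [volume_closedBall_two_zpow, Real.volume_pi_closedBall _ (by positivity),
        Fintype.card_fin, show (2 * (5 * (2 : ℝ) ^ k x)) ^ m = 5 ^ m * (2 * 2 ^ k x) ^ m by
          rw [← mul_pow]; ring, ENNReal.ofReal_mul (by positivity),
        ENNReal.ofReal_pow (by norm_num)]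
      norm_num
    rw [h1]
    gcongr
    have h2 := (hk x hx).2.le
    rw [mul_comm, ← div_eq_mul_inv, ENNReal.le_div_iff_mul_le
      (Or.inl (volume_closedBall_two_zpow_ne_zero x _))
      (Or.inl (volume_closedBall_two_zpow_ne_top x _))] at h2
    rw [mul_comm, ← div_eq_mul_inv, ENNReal.le_div_iff_mul_le (Or.inl ht) (Or.inl ht'), mul_comm]
    exact h2
  calc volume S ≤ volume (⋃ x : u, Metric.closedBall (x : Fin m → ℝ) (5 * (2 : ℝ) ^ k x)) := by
        refine measure_mono fun x hx => ?_
        obtain ⟨b, hb, hsub⟩ := hcov x hx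
        exact Set.mem_iUnion.2 ⟨⟨b, hb⟩, hsub (Metric.mem_closedBall_self (by positivity))⟩
    _ ≤ ∑' x : u, volume (Metric.closedBall (x : Fin m → ℝ) (5 * (2 : ℝ) ^ k x)) :=
        measure_iUnion_le _
    _ ≤ ∑' x : u, 5 ^ m *
          (t⁻¹ * ∫⁻ y in Metric.closedBall (x : Fin m → ℝ) ((2 : ℝ) ^ k x), g y) :=
        ENNReal.tsum_le_tsum fun x => hball x (huS x.2)
    _ = 5 ^ m * (t⁻¹ * ∫⁻ y in ⋃ x : u, Metric.closedBall (x : Fin m → ℝ) ((2 : ℝ) ^ k x), g y) := by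
        rw [ENNReal.tsum_mul_left, ENNReal.tsum_mul_left,
          lintegral_iUnion (fun _ => Metric.isClosed_closedBall.measurableSet)
            (hdisj.subtype _ _)]
    _ ≤ _ := by gcongr; exact Measure.restrict_le_self

lemma volume_lt_cubeMaximal_le {g : (Fin m → ℝ) → ℝ≥0∞} {t : ℝ≥0∞} (ht : t ≠ 0) (ht' : t ≠ ⊤) :
    volume {x : Fin m → ℝ | t < cubeMaximal g x} ≤ 5 ^ m * (t⁻¹ * ∫⁻ y, g y) := by
  have hU : {x : Fin m → ℝ | t < cubeMaximal g x} = ⋃ K : ℕ, {x : Fin m → ℝ | ∃ k : ℤ, k ≤ K ∧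
      t < (volume (Metric.closedBall x ((2 : ℝ) ^ k)))⁻¹ *
        ∫⁻ y in Metric.closedBall x ((2 : ℝ) ^ k), g y} := by
    ext x
    simp only [cubeMaximal, lt_iSup_iff, Set.mem_ofPred_eq, Set.mem_iUnion]
    exact ⟨fun ⟨k, hk⟩ => ⟨k.toNat, k, Int.self_le_toNat k, hk⟩, fun ⟨_, k, _, hk⟩ => ⟨k, hk⟩⟩
  rw [hU, Monotone.measure_iUnion]
  · exact iSup_le fun K => volume_le_of_forall_exists_average_gt ht ht' K
  · rintro K L hKL x ⟨k, hk, hx⟩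
    exact ⟨k, hk.trans (by exact_mod_cast hKL), hx⟩

lemma volume_two_mul_lt_cubeMaximal_le {f : (Fin m → ℝ) → ℝ≥0∞} (hf : Measurable f) {t : ℝ≥0∞}
    (ht : t ≠ 0) (ht' : t ≠ ⊤) :
    volume {x : Fin m → ℝ | 2 * t < cubeMaximal f x} ≤
      5 ^ m * (t⁻¹ * ∫⁻ y, {y | t < f y}.indicator f y) := by
  have hs : MeasurableSet {y | t < f y} := measurableSet_lt measurable_const hf
  refine (measure_mono fun x hx => ?_).trans (volume_lt_cubeMaximal_le ht ht')
  have h := cubeMaximal_add_const_le (g := f) (hf.indicator hs) t (fun y => by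
    by_cases hy : t < f y
    · rw [Set.indicator_of_mem (by exact hy)]; exact le_self_add
    · exact (not_lt.1 hy).trans le_add_self) x
  have h' := (show 2 * t < cubeMaximal f x from hx).trans_le h
  rw [two_mul] at h'
  exact lt_of_add_lt_add_right h'

lemma ENNReal.sq_eq_lintegral_indicator (a : ℝ≥0∞) :
    a ^ 2 = ∫⁻ t in Set.Ioi (0 : ℝ), {t : ℝ | ENNReal.ofReal t < a}.indicator
      (fun t => ENNReal.ofReal (2 * t)) t := by
  have hs : MeasurableSet {t : ℝ | ENNReal.ofReal t < a} :=
    measurableSet_lt ENNReal.measurable_ofReal measurable_const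
  rw [lintegral_indicator hs, Measure.restrict_restrict hs]
  by_cases ha : a = ⊤
  · subst ha
    rw [eq_comm, ENNReal.top_pow two_ne_zero, eq_top_iff]
    calc (⊤ : ℝ≥0∞) = ∫⁻ t in Set.Ioi (1 : ℝ), 1 := by simp
      _ ≤ ∫⁻ t in Set.Ioi (1 : ℝ), ENNReal.ofReal (2 * t) := by
        refine setLIntegral_mono (by fun_prop) fun t ht => ?_
        rw [ENNReal.one_le_ofReal]
        linarith [Set.mem_Ioi.1 ht]
      _ ≤ _ := lintegral_mono_set (Set.subset_inter (fun t _ => ENNReal.ofReal_lt_top)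
        (Set.Ioi_subset_Ioi zero_le_one))
  · have h0 : 0 ≤ a.toReal := ENNReal.toReal_nonneg
    have : {t : ℝ | ENNReal.ofReal t < a} ∩ Set.Ioi 0 = Set.Ioo 0 a.toReal := by
      ext t
      simp only [Set.mem_inter_iff, Set.mem_ofPred_eq, Set.mem_Ioi, Set.mem_Ioo]
      constructor
      · rintro ⟨h, h'⟩
        exact ⟨h', (ENNReal.ofReal_lt_iff_lt_toReal h'.le ha).1 h⟩
      · rintro ⟨h, h'⟩
        exact ⟨(ENNReal.ofReal_lt_iff_lt_toReal h.le ha).2 h', h⟩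
    rw [this, ← setLIntegral_congr Ioo_ae_eq_Ioc.symm, ← ofReal_integral_eq_lintegral_ofReal,
      ← intervalIntegral.integral_of_le h0, intervalIntegral.integral_const_mul, integral_id,
      ← ENNReal.ofReal_toReal ha, ← ENNReal.ofReal_pow h0]
    · congr 1
      rw [ENNReal.toReal_ofReal h0]
      ring
    · exact (by fun_prop : Continuous fun t : ℝ => 2 * t).integrableOn_Ioc
    · refine (ae_restrict_iff' measurableSet_Ioc).2 (Eventually.of_forall fun t ht => ?_)
      have := ht.1
      simp only [Pi.zero_apply]
      positivity

lemma lintegral_cubeMaximal_sq_le {f : (Fin m → ℝ) → ℝ≥0∞} (hf : Measurable f) :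
    ∫⁻ x, cubeMaximal f x ^ 2 ≤ 8 * 5 ^ m * ∫⁻ x, f x ^ 2 := by
  have hM : Measurable (cubeMaximal f) :=
    measurable_cubeMaximal_prod (α := Fin m → ℝ) (g := fun _ => f) (hf.comp measurable_snd)
      measurable_id
  have hS : MeasurableSet {p : (Fin m → ℝ) × ℝ | ENNReal.ofReal p.2 < cubeMaximal f p.1} :=
    measurableSet_lt (by fun_prop) (hM.comp measurable_fst)
  have hT : MeasurableSet {p : ℝ × (Fin m → ℝ) | ENNReal.ofReal (p.1 / 2) < f p.2} :=
    measurableSet_lt (by fun_prop) (hf.comp measurable_snd)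
  calc ∫⁻ x, cubeMaximal f x ^ 2
      = ∫⁻ x, ∫⁻ t in Set.Ioi (0 : ℝ), {p : (Fin m → ℝ) × ℝ |
          ENNReal.ofReal p.2 < cubeMaximal f p.1}.indicator
            (fun p => ENNReal.ofReal (2 * p.2)) (x, t) := by
        simp_rw [ENNReal.sq_eq_lintegral_indicator (cubeMaximal f _)]
        rfl
    _ = ∫⁻ t in Set.Ioi (0 : ℝ), ∫⁻ x, {p : (Fin m → ℝ) × ℝ |
          ENNReal.ofReal p.2 < cubeMaximal f p.1}.indicator
            (fun p => ENNReal.ofReal (2 * p.2)) (x, t) :=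
        lintegral_lintegral_swap (Measurable.aemeasurable
          (Measurable.indicator (by fun_prop) hS))
    _ ≤ ∫⁻ t in Set.Ioi (0 : ℝ), 4 * 5 ^ m *
          ∫⁻ y, {y | ENNReal.ofReal (t / 2) < f y}.indicator f y := by
        refine setLIntegral_mono' measurableSet_Ioi fun t ht => ?_
        have ht : 0 < t := ht
        have h2 : ENNReal.ofReal t = 2 * ENNReal.ofReal (t / 2) := by
          rw [← ENNReal.ofReal_ofNat 2, ← ENNReal.ofReal_mul (by norm_num)]
          congr 1
          ring
        have h0 : ENNReal.ofReal (t / 2) ≠ 0 := by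
          rw [Ne, ENNReal.ofReal_eq_zero, not_le]
          positivity
        calc _ = ∫⁻ x, {x | 2 * ENNReal.ofReal (t / 2) < cubeMaximal f x}.indicator
                (fun _ => ENNReal.ofReal (2 * t)) x := by
              rw [← h2]
              rfl
          _ = ENNReal.ofReal (2 * t) *
                volume {x | 2 * ENNReal.ofReal (t / 2) < cubeMaximal f x} :=
              lintegral_indicator_const (measurableSet_lt measurable_const hM) _
          _ ≤ ENNReal.ofReal (2 * t) * (5 ^ m * ((ENNReal.ofReal (t / 2))⁻¹ *
                ∫⁻ y, {y | ENNReal.ofReal (t / 2) < f y}.indicator f y)) := by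
              gcongr
              exact volume_two_mul_lt_cubeMaximal_le hf h0 ENNReal.ofReal_ne_top
          _ = (ENNReal.ofReal (2 * t) * (ENNReal.ofReal (t / 2))⁻¹) * 5 ^ m *
                ∫⁻ y, {y | ENNReal.ofReal (t / 2) < f y}.indicator f y := by ring
          _ = _ := by
              rw [ENNReal.ofReal_mul (by norm_num), h2, ← mul_assoc, mul_assoc _ (ENNReal.ofReal _),
                ENNReal.mul_inv_cancel h0 ENNReal.ofReal_ne_top]
              norm_num
    _ = 4 * 5 ^ m * ∫⁻ t in Set.Ioi (0 : ℝ), ∫⁻ y, {p : ℝ × (Fin m → ℝ) |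
          ENNReal.ofReal (p.1 / 2) < f p.2}.indicator (fun p => f p.2) (t, y) := by
        rw [← lintegral_const_mul]
        · rfl
        · exact Measurable.lintegral_prod_right'
            (Measurable.indicator (hf.comp measurable_snd) hT)
    _ = 4 * 5 ^ m * ∫⁻ y, ∫⁻ t in Set.Ioi (0 : ℝ), {p : ℝ × (Fin m → ℝ) |
          ENNReal.ofReal (p.1 / 2) < f p.2}.indicator (fun p => f p.2) (t, y) := by
        rw [lintegral_lintegral_swap]
        exact Measurable.aemeasurable (Measurable.indicator (hf.comp measurable_snd) hT)
    _ ≤ 4 * 5 ^ m * ∫⁻ y, 2 * f y ^ 2 := by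
        gcongr with y
        have hs : MeasurableSet {t : ℝ | ENNReal.ofReal (t / 2) < f y} :=
          measurableSet_lt (by fun_prop) measurable_const
        calc _ = ∫⁻ t in Set.Ioi (0 : ℝ), {t : ℝ | ENNReal.ofReal (t / 2) < f y}.indicator
                (fun _ => f y) t := rfl
          _ = f y * volume ({t : ℝ | ENNReal.ofReal (t / 2) < f y} ∩ Set.Ioi 0) := by
              rw [lintegral_indicator_const hs, Measure.restrict_apply hs]
          _ ≤ f y * (2 * f y) := by
              gcongr
              by_cases hy : f y = ⊤
              · simp [hy]
              · calc _ ≤ volume (Set.Ioo 0 (2 * (f y).toReal)) := by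
                      refine measure_mono fun t ht => ⟨ht.2, ?_⟩
                      have h0 : (0 : ℝ) < t := ht.2
                      have := (ENNReal.ofReal_lt_iff_lt_toReal (by positivity) hy).1 ht.1
                      linarith
                  _ = 2 * f y := by
                      rw [Real.volume_Ioo, sub_zero, ENNReal.ofReal_mul (by norm_num),
                        ENNReal.ofReal_toReal hy]
                      norm_num
          _ = 2 * f y ^ 2 := by ring
    _ = 8 * 5 ^ m * ∫⁻ x, f x ^ 2 := by
        rw [lintegral_const_mul _ (by fun_prop)]
        ring

end CubeMaximal

section IterMaximal

variable {m d : ℕ} {n : Fin d → ℕ}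

lemma cubeSet_eq_pi (Q : Cube m) :
    cubeSet Q = Set.univ.pi fun i => Set.Ico (Q.corner i) (Q.corner i + Q.side) := by
  ext x
  simp [cubeSet, Set.mem_pi]

lemma measurableSet_cubeSet (Q : Cube m) : MeasurableSet (cubeSet Q) := by
  rw [cubeSet_eq_pi]
  exact MeasurableSet.univ_pi fun _ => measurableSet_Ico

lemma volume_cubeSet (Q : Cube m) : volume (cubeSet Q) = ENNReal.ofReal (Q.side ^ m) := by
  rw [cubeSet_eq_pi, Real.volume_pi_Ico]
  simp [ENNReal.ofReal_pow Q.side_pos.le]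

lemma rectSet_eq_pi (R : Rect n) : rectSet R = Set.univ.pi fun i => cubeSet (R i) := by
  ext x
  simp [rectSet, Set.mem_pi]

lemma measurableSet_rectSet (R : Rect n) : MeasurableSet (rectSet R) := by
  rw [rectSet_eq_pi]
  exact MeasurableSet.univ_pi fun _ => measurableSet_cubeSet _

lemma volume_rectSet (R : Rect n) : volume (rectSet R) = ∏ i, volume (cubeSet (R i)) := by
  rw [rectSet_eq_pi, volume_pi_pi]

lemma volume_rectSet_ne_zero (R : Rect n) : volume (rectSet R) ≠ 0 := by
  rw [volume_rectSet, Finset.prod_ne_zero_iff]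
  intro i _
  rw [volume_cubeSet, Ne, ENNReal.ofReal_eq_zero, not_le]
  exact pow_pos (R i).side_pos _

lemma volume_rectSet_ne_top (R : Rect n) : volume (rectSet R) ≠ ⊤ := by
  rw [volume_rectSet]
  refine ENNReal.prod_ne_top fun i _ => ?_
  rw [volume_cubeSet]
  exact ENNReal.ofReal_ne_top

lemma setLIntegral_cubeSet_le_cubeMaximal (g : (Fin m → ℝ) → ℝ≥0∞) (Q : Cube m) {y : Fin m → ℝ}
    (hy : y ∈ cubeSet Q) :
    ∫⁻ z in cubeSet Q, g z ≤ 4 ^ m * volume (cubeSet Q) * cubeMaximal g y := by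
  obtain ⟨k, hk1, hk2⟩ := exists_mem_Ioc_zpow Q.side_pos (one_lt_two (α := ℝ))
  have hsub : cubeSet Q ⊆ Metric.closedBall y ((2 : ℝ) ^ (k + 1)) := by
    intro z hz
    rw [Metric.mem_closedBall, dist_pi_le_iff (by positivity)]
    intro i
    rw [Real.dist_eq, abs_le]
    have h1 := hy i
    have h2 := hz i
    constructor <;> linarith
  have hvol : volume (Metric.closedBall y ((2 : ℝ) ^ (k + 1))) ≤ 4 ^ m * volume (cubeSet Q) := by
    rw [volume_closedBall_two_zpow, volume_cubeSet,
      show (4 : ℝ≥0∞) = ENNReal.ofReal 4 by norm_num, ← ENNReal.ofReal_pow (by norm_num),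
      ← ENNReal.ofReal_mul (by positivity), ← mul_pow]
    refine ENNReal.ofReal_le_ofReal (pow_le_pow_left₀ (by positivity) ?_ _)
    rw [zpow_add_one₀ two_ne_zero]
    linarith
  calc ∫⁻ z in cubeSet Q, g z
      ≤ ∫⁻ z in Metric.closedBall y ((2 : ℝ) ^ (k + 1)), g z := lintegral_mono_set hsub
    _ = volume (Metric.closedBall y ((2 : ℝ) ^ (k + 1))) *
          ((volume (Metric.closedBall y ((2 : ℝ) ^ (k + 1))))⁻¹ *
            ∫⁻ z in Metric.closedBall y ((2 : ℝ) ^ (k + 1)), g z) := by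
        rw [← mul_assoc, ENNReal.mul_inv_cancel (volume_closedBall_two_zpow_ne_zero _ _)
          (volume_closedBall_two_zpow_ne_top _ _), one_mul]
    _ ≤ _ := by
        gcongr
        exact le_iSup (fun k : ℤ => (volume (Metric.closedBall y ((2 : ℝ) ^ k)))⁻¹ *
          ∫⁻ z in Metric.closedBall y ((2 : ℝ) ^ k), g z) (k + 1)

lemma measurable_blockMaximal (i : Fin d) {f : ProductSpace n → ℝ≥0∞} (hf : Measurable f) :
    Measurable (blockMaximal i f) := by
  refine measurable_cubeMaximal_prod (g := fun x y => f (Function.update x i y)) ?_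
    (measurable_pi_apply i)
  refine hf.comp (measurable_pi_iff.2 fun j => ?_)
  by_cases hj : j = i
  · subst hj
    simpa using measurable_snd
  · simpa [Function.update_of_ne hj] using measurable_fst.eval (a := j)

lemma lintegral_blockMaximal_sq_le (i : Fin d) {f : ProductSpace n → ℝ≥0∞} (hf : Measurable f) :
    ∫⁻ x, blockMaximal i f x ^ 2 ≤ 8 * 5 ^ n i * ∫⁻ x, f x ^ 2 := by
  rw [← lintegral_const_mul _ (by fun_prop)]
  refine lintegral_le_of_lmarginal_le (μ := fun _ => volume) {i}
    ((measurable_blockMaximal i hf).pow_const 2) (by fun_prop) fun x => ?_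
  simp only [lmarginal_singleton]
  have hfi : Measurable fun y => f (Function.update x i y) := hf.comp (measurable_update x)
  rw [lintegral_const_mul _ (by fun_prop)]
  simpa [blockMaximal] using lintegral_cubeMaximal_sq_le hfi

lemma measurable_iterMaximal (l : List (Fin d)) {f : ProductSpace n → ℝ≥0∞} (hf : Measurable f) :
    Measurable (iterMaximal l f) := by
  induction l with
  | nil => exact hf
  | cons i l ih => exact measurable_blockMaximal i ih

lemma iterMaximal_const_mul (l : List (Fin d)) (c : ℝ≥0∞) {f : ProductSpace n → ℝ≥0∞}
    (hf : Measurable f) : iterMaximal l (fun y => c * f y) = fun x => c * iterMaximal l f x := by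
  induction l with
  | nil => rfl
  | cons i l ih =>
    funext x
    change blockMaximal i (iterMaximal l fun y => c * f y) x = c * blockMaximal i _ x
    rw [ih]
    exact cubeMaximal_const_mul c ((measurable_iterMaximal l hf).comp (measurable_update x)) _

lemma iterMaximal_tsum_le (l : List (Fin d)) {f : ℕ → ProductSpace n → ℝ≥0∞}
    (hf : ∀ j, Measurable (f j)) (x : ProductSpace n) :
    iterMaximal l (fun y => ∑' j, f j y) x ≤ ∑' j, iterMaximal l (f j) x := by
  induction l generalizing x with
  | nil => exact le_rfl
  | cons i l ih =>
    calc blockMaximal i (iterMaximal l fun y => ∑' j, f j y) x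
        ≤ blockMaximal i (fun y => ∑' j, iterMaximal l (f j) y) x :=
          cubeMaximal_mono (fun y => ih _) _
      _ ≤ _ := cubeMaximal_tsum_le
          (fun j => (measurable_iterMaximal l (hf j)).comp (measurable_update x)) _

lemma lintegral_iterMaximal_sq_le (l : List (Fin d)) {f : ProductSpace n → ℝ≥0∞}
    (hf : Measurable f) :
    ∫⁻ x, iterMaximal l f x ^ 2 ≤ (l.map fun i => 8 * 5 ^ n i).prod * ∫⁻ x, f x ^ 2 := by
  induction l with
  | nil => simp [iterMaximal]
  | cons i l ih =>
    rw [List.map_cons, List.prod_cons, mul_assoc]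
    refine (lintegral_blockMaximal_sq_le i (measurable_iterMaximal l hf)).trans ?_
    gcongr

lemma lmarginal_le_iterMaximal {l : List (Fin d)} (hl : l.Nodup) {f : ProductSpace n → ℝ≥0∞}
    (hf : Measurable f) (R : Rect n) {x : ProductSpace n} (hx : x ∈ rectSet R) :
    (∫⋯∫⁻_l.toFinset, f ∂fun i => volume.restrict (cubeSet (R i))) x ≤
      (∏ i ∈ l.toFinset, 4 ^ n i * volume (cubeSet (R i))) * iterMaximal l f x := by
  induction l generalizing x with
  | nil => simp [iterMaximal]
  | cons i l ih =>
    rw [List.nodup_cons] at hl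
    have hi : i ∉ l.toFinset := by simpa using hl.1
    rw [List.toFinset_cons, lmarginal_insert f hf hi, Finset.prod_insert hi]
    have hxi : ∀ y ∈ cubeSet (R i), Function.update x i y ∈ rectSet R := by
      intro y hy j
      by_cases hj : j = i
      · subst hj
        simpa using hy
      · simpa [Function.update_of_ne hj] using hx j
    have hmeas : Measurable fun y => iterMaximal l f (Function.update x i y) :=
      (measurable_iterMaximal l hf).comp (measurable_update x)
    calc _ ≤ ∫⁻ y in cubeSet (R i), (∏ j ∈ l.toFinset, 4 ^ n j * volume (cubeSet (R j))) *
            iterMaximal l f (Function.update x i y) :=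
          setLIntegral_mono' (measurableSet_cubeSet _) fun y hy => ih hl.2 (hxi y hy)
      _ = (∏ j ∈ l.toFinset, 4 ^ n j * volume (cubeSet (R j))) *
            ∫⁻ y in cubeSet (R i), iterMaximal l f (Function.update x i y) :=
          lintegral_const_mul _ hmeas
      _ ≤ (∏ j ∈ l.toFinset, 4 ^ n j * volume (cubeSet (R j))) *
            (4 ^ n i * volume (cubeSet (R i)) * blockMaximal i (iterMaximal l f) x) := by
          gcongr
          exact setLIntegral_cubeSet_le_cubeMaximal _ (R i) (hx i)
      _ = _ := by
          simp only [iterMaximal, List.foldr_cons]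
          ring

lemma setLIntegral_rectSet_le_iterMaximal {f : ProductSpace n → ℝ≥0∞} (hf : Measurable f)
    (R : Rect n) {x : ProductSpace n} (hx : x ∈ rectSet R) :
    ∫⁻ y in rectSet R, f y ≤
      (∏ i, 4 ^ n i) * volume (rectSet R) * iterMaximal (List.finRange d) f x := by
  have h := lmarginal_le_iterMaximal (List.nodup_finRange d) hf R hx
  rw [List.toFinset_finRange, lmarginal_univ, Finset.prod_mul_distrib, ← volume_rectSet] at h
  rwa [rectSet_eq_pi, volume_pi, Measure.restrict_pi_pi, ← volume_pi, ← rectSet_eq_pi]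

end IterMaximal

section Majorant

lemma ENNReal.tsum_inv_two_pow : ∑' j : ℕ, (2⁻¹ : ℝ≥0∞) ^ j = 2 := by
  rw [ENNReal.tsum_geometric, ENNReal.one_sub_inv_two, inv_inv]

lemma ENNReal.tsum_sq_le (a : ℕ → ℝ≥0∞) : (∑' j, a j) ^ 2 ≤ 4 * ∑' j, 4 ^ j * a j ^ 2 := by
  set s := ∑' j, 4 ^ j * a j ^ 2 with hs
  have hr : (s ^ (2⁻¹ : ℝ)) ^ 2 = s := by
    rw [← ENNReal.rpow_two, ← ENNReal.rpow_mul]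
    norm_num
  have ha : ∀ j, a j ≤ 2⁻¹ ^ j * s ^ (2⁻¹ : ℝ) := by
    intro j
    have h1 : (2 ^ j * a j) ^ 2 ≤ s := by
      rw [mul_pow, ← pow_mul, mul_comm j 2, pow_mul]
      norm_num
      exact ENNReal.le_tsum (f := fun j => 4 ^ j * a j ^ 2) j
    have h2 : 2 ^ j * a j ≤ s ^ (2⁻¹ : ℝ) := by
      rw [ENNReal.le_rpow_inv_iff two_pos, ENNReal.rpow_two]
      exact h1
    calc a j = 2⁻¹ ^ j * (2 ^ j * a j) := by
          rw [← mul_assoc, ← mul_pow, ENNReal.inv_mul_cancel (by norm_num) (by norm_num),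
            one_pow, one_mul]
      _ ≤ _ := by gcongr
  calc (∑' j, a j) ^ 2 ≤ (∑' j : ℕ, 2⁻¹ ^ j * s ^ (2⁻¹ : ℝ)) ^ 2 := by
        gcongr with j
        exact ha j
    _ = 4 * s := by
        rw [ENNReal.tsum_mul_right, ENNReal.tsum_inv_two_pow, mul_pow, hr]
        norm_num

/-- The Rubio de Francia iteration for a countably subadditive, homogeneous operator bounded
on `L²`. -/
lemma exists_majorant_of_sublinear {α : Type*} [MeasurableSpace α] {μ : Measure α}
    {T : (α → ℝ≥0∞) → α → ℝ≥0∞} (hT : ∀ f, Measurable f → Measurable (T f))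
    (hmul : ∀ (c : ℝ≥0∞) (f : α → ℝ≥0∞), Measurable f → T (fun y => c * f y) = fun x => c * T f x)
    (hsum : ∀ f : ℕ → α → ℝ≥0∞, (∀ j, Measurable (f j)) → ∀ x,
      T (fun y => ∑' j, f j y) x ≤ ∑' j, T (f j) x)
    {A : ℝ≥0∞} (hA : A ≠ ⊤)
    (hL2 : ∀ f, Measurable f → ∫⁻ x, T f x ^ 2 ∂μ ≤ A * ∫⁻ x, f x ^ 2 ∂μ)
    {f : α → ℝ≥0∞} (hf : Measurable f) :
    ∃ u : α → ℝ≥0∞, Measurable u ∧ f ≤ u ∧ (∀ x, T u x ≤ 8 * (A + 1) * u x) ∧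
      ∫⁻ x, u x ^ 2 ∂μ ≤ 8 * ∫⁻ x, f x ^ 2 ∂μ := by
  set D : ℝ≥0∞ := 8 * (A + 1) with hD
  have hD0 : D ≠ 0 := by simp [hD]
  have hDt : D ≠ ⊤ := ENNReal.mul_ne_top (by norm_num) (by simp [hA])
  have hTj : ∀ j, Measurable (T^[j] f) := by
    intro j
    induction j with
    | zero => exact hf
    | succ j ih => rw [Function.iterate_succ_apply']; exact hT _ ih
  have hj : ∀ j, ∫⁻ x, (T^[j] f) x ^ 2 ∂μ ≤ A ^ j * ∫⁻ x, f x ^ 2 ∂μ := by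
    intro j
    induction j with
    | zero => simp
    | succ j ih =>
      rw [Function.iterate_succ_apply', pow_succ', mul_assoc]
      refine (hL2 _ (hTj j)).trans ?_
      gcongr
  have hmeas : ∀ j, Measurable fun x => D⁻¹ ^ j * (T^[j] f) x := fun j => (hTj j).const_mul _
  refine ⟨fun x => ∑' j, D⁻¹ ^ j * (T^[j] f) x, Measurable.tsum hmeas, fun x => ?_,
    fun x => ?_, ?_⟩
  · simpa using ENNReal.le_tsum (f := fun j => D⁻¹ ^ j * (T^[j] f) x) 0
  · calc _ ≤ ∑' j, T (fun y => D⁻¹ ^ j * (T^[j] f) y) x := hsum _ hmeas x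
      _ = ∑' j, D * (D⁻¹ ^ (j + 1) * (T^[j + 1] f) x) := by
        refine tsum_congr fun j => ?_
        rw [hmul _ _ (hTj j), Function.iterate_succ_apply', pow_succ', ← mul_assoc, ← mul_assoc,
          ENNReal.mul_inv_cancel hD0 hDt, one_mul]
      _ ≤ _ := by
        rw [ENNReal.tsum_mul_left]
        gcongr
        exact ENNReal.tsum_comp_le_tsum_of_injective (add_left_injective 1)
          fun j => D⁻¹ ^ j * (T^[j] f) x
  · have hratio : 4 * D⁻¹ ^ 2 * A ≤ 2⁻¹ := by
      have h1 : D⁻¹ ≤ 1 := by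
        rw [ENNReal.inv_le_one]
        calc (1 : ℝ≥0∞) ≤ 8 * 1 := by norm_num
          _ ≤ D := by rw [hD]; gcongr; exact le_add_self
      calc 4 * D⁻¹ ^ 2 * A = 2⁻¹ * (D⁻¹ * (D⁻¹ * (8 * A))) := by
            rw [show (8 : ℝ≥0∞) = 2 * 4 by norm_num]
            have : (2⁻¹ : ℝ≥0∞) * 2 = 1 := ENNReal.inv_mul_cancel (by norm_num) (by norm_num)
            calc _ = (2⁻¹ * 2) * (4 * D⁻¹ ^ 2 * A) := by rw [this, one_mul]
              _ = _ := by ring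
        _ ≤ 2⁻¹ * (1 * (D⁻¹ * D)) := by
            gcongr
            rw [hD]
            gcongr
            exact le_self_add
        _ = 2⁻¹ := by rw [ENNReal.inv_mul_cancel hD0 hDt]; simp
    calc _ ≤ ∫⁻ x, 4 * ∑' j, 4 ^ j * (D⁻¹ ^ j * (T^[j] f) x) ^ 2 ∂μ :=
          lintegral_mono fun x => ENNReal.tsum_sq_le _
      _ = 4 * ∑' j, 4 ^ j * ((D⁻¹ ^ j) ^ 2 * ∫⁻ x, (T^[j] f) x ^ 2 ∂μ) := by
          rw [lintegral_const_mul _ (Measurable.tsum fun j => by fun_prop),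
            lintegral_tsum fun j => by fun_prop]
          congr 1
          refine tsum_congr fun j => ?_
          simp_rw [mul_pow]
          rw [lintegral_const_mul _ (by fun_prop), lintegral_const_mul _ (by fun_prop)]
      _ ≤ 4 * ∑' j, 4 ^ j * ((D⁻¹ ^ j) ^ 2 * (A ^ j * ∫⁻ x, f x ^ 2 ∂μ)) := by
          gcongr with j
          exact hj j
      _ = 4 * ∑' j, (4 * D⁻¹ ^ 2 * A) ^ j * ∫⁻ x, f x ^ 2 ∂μ := by
          congr 1
          refine tsum_congr fun j => ?_
          ring
      _ ≤ 4 * ∑' j : ℕ, 2⁻¹ ^ j * ∫⁻ x, f x ^ 2 ∂μ := by gcongr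
      _ = 8 * ∫⁻ x, f x ^ 2 ∂μ := by
          rw [ENNReal.tsum_mul_right, ENNReal.tsum_inv_two_pow, ← mul_assoc]
          norm_num

end Majorant

section Oscillation

variable {d : ℕ} {n : Fin d → ℕ}

/-- The oscillation about the average is at most twice the oscillation about any constant. -/
lemma lintegral_sub_average_le {α : Type*} [MeasurableSpace α] {ν : Measure α} [IsFiniteMeasure ν]
    {f : α → ℝ} (hf : Integrable f ν) (c : ℝ) :
    ∫⁻ x, ENNReal.ofReal |f x - ⨍ y, f y ∂ν| ∂ν ≤ 2 * ∫⁻ x, ENNReal.ofReal |f x - c| ∂ν := by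
  set a := ⨍ y, f y ∂ν with ha
  have hmean : ENNReal.ofReal |c - a| * ν Set.univ ≤ ∫⁻ x, ENNReal.ofReal |f x - c| ∂ν := by
    have h1 : ∫ x, (f x - c) ∂ν = ν.real Set.univ * (a - c) := by
      rw [integral_sub hf (integrable_const c), integral_const, ← measure_smul_average ν f,
        smul_eq_mul, smul_eq_mul, mul_sub]
    have h2 := enorm_integral_le_lintegral_enorm (μ := ν) fun x => f x - c
    rw [h1] at h2
    simp only [Real.enorm_eq_ofReal_abs, abs_mul, abs_of_nonneg (measureReal_nonneg)] at h2
    rwa [ENNReal.ofReal_mul measureReal_nonneg, ofReal_measureReal, mul_comm, abs_sub_comm] at h2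
  calc _ ≤ ∫⁻ x, (ENNReal.ofReal |f x - c| + ENNReal.ofReal |c - a|) ∂ν := by
        refine lintegral_mono fun x => ?_
        rw [← ENNReal.ofReal_add (abs_nonneg _) (abs_nonneg _)]
        exact ENNReal.ofReal_le_ofReal (abs_sub_le _ _ _)
    _ = ∫⁻ x, ENNReal.ofReal |f x - c| ∂ν + ENNReal.ofReal |c - a| * ν Set.univ := by
        rw [lintegral_add_right _ measurable_const, lintegral_const]
    _ ≤ _ := by
        rw [two_mul]
        gcongr

/-- The truncation of `1 + δ log w` to the unit interval. -/
noncomputable def truncLog (δ w : ℝ) : ℝ := max 0 (min 1 (1 + δ * Real.log w))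

lemma truncLog_mem_Icc (δ w : ℝ) : truncLog δ w ∈ Set.Icc (0 : ℝ) 1 :=
  ⟨le_max_left _ _, max_le zero_le_one (min_le_left _ _)⟩

lemma measurable_truncLog (δ : ℝ) : Measurable (truncLog δ) := by
  unfold truncLog
  fun_prop

lemma truncLog_eq_one {δ w : ℝ} (hδ : 0 ≤ δ) (hw : 1 ≤ w) : truncLog δ w = 1 := by
  have := mul_nonneg hδ (Real.log_nonneg hw)
  rw [truncLog, min_eq_left (by linarith), max_eq_right zero_le_one]

lemma exp_lt_of_truncLog_pos {δ w : ℝ} (hδ : 0 < δ) (hw : 0 < w) (h : 0 < truncLog δ w) :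
    Real.exp (-(1 / δ)) < w := by
  rw [truncLog, lt_max_iff, lt_min_iff] at h
  have h1 := (h.resolve_left (lt_irrefl _)).2
  rw [← Real.lt_log_iff_exp_lt hw, neg_lt, lt_div_iff₀' hδ]
  linarith

lemma abs_truncLog_sub_le {δ w m K : ℝ} (hδ : 0 < δ) (hw : 0 < w) (hm : 0 < m) (hK : 0 ≤ K)
    (h : m ≤ K * w) : |truncLog δ w - truncLog δ m| ≤ δ * (w / m + K) := by
  have hlog : |Real.log w - Real.log m| ≤ w / m + K := by
    have h1 := Real.log_le_sub_one_of_pos (div_pos hw hm)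
    have h2 := Real.log_le_sub_one_of_pos (div_pos hm hw)
    have h3 : m / w ≤ K := (div_le_iff₀ hw).2 h
    have h4 : 0 < w / m := div_pos hw hm
    rw [Real.log_div hw.ne' hm.ne'] at h1
    rw [Real.log_div hm.ne' hw.ne'] at h2
    rw [abs_le]
    constructor <;> linarith
  calc _ ≤ |min 1 (1 + δ * Real.log w) - min 1 (1 + δ * Real.log m)| := by
        simpa [truncLog, max_comm] using
          abs_max_sub_max_le_abs (min 1 (1 + δ * Real.log w)) (min 1 (1 + δ * Real.log m)) 0
    _ ≤ |(1 + δ * Real.log w) - (1 + δ * Real.log m)| := by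
        simpa using abs_min_sub_min_le_max 1 (1 + δ * Real.log w) 1 (1 + δ * Real.log m)
    _ = δ * |Real.log w - Real.log m| := by
        rw [add_sub_add_left_eq_sub, ← mul_sub, abs_mul, abs_of_pos hδ]
    _ ≤ _ := by gcongr

lemma bmo1_truncLog_le {u : ProductSpace n → ℝ≥0∞} (hu : Measurable u)
    (hfin : ∀ᵐ x, u x < ⊤) {K : ℝ} (hK : 0 ≤ K)
    (hA : ∀ (R : Rect n), ∀ x ∈ rectSet R,
      ∫⁻ y in rectSet R, u y ≤ ENNReal.ofReal K * volume (rectSet R) * u x)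
    {δ η : ℝ} (hδ : 0 < δ) (hη : 0 < η) :
    bmo1 (fun x => truncLog δ ((u x).toReal + η)) ≤ ENNReal.ofReal (2 * (K + 2) * δ) := by
  refine iSup_le fun R => ?_
  set V := volume (rectSet R) with hV
  have hV0 : V ≠ 0 := volume_rectSet_ne_zero R
  have hVt : V ≠ ⊤ := volume_rectSet_ne_top R
  have hR := measurableSet_rectSet R
  have : IsFiniteMeasure (volume.restrict (rectSet R)) :=
    ⟨by rw [Measure.restrict_apply_univ]; exact hVt.lt_top⟩
  set I := ∫⁻ y in rectSet R, u y with hI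
  have hIt : I ≠ ⊤ := by
    obtain ⟨x, hx, hxu⟩ : ∃ x ∈ rectSet R, u x < ⊤ := by
      by_contra! h
      refine hV0 (measure_mono_null (fun x hx => ?_) hfin)
      exact not_lt.2 (h x hx)
    exact ne_top_of_le_ne_top
      (ENNReal.mul_ne_top (ENNReal.mul_ne_top ENNReal.ofReal_ne_top hVt) hxu.ne) (hA R x hx)
  have hIV : I / V ≠ ⊤ := ENNReal.div_ne_top hIt hV0
  set M := (I / V).toReal + η with hM
  have hMpos : 0 < M := by positivity
  have hpt : ∀ᵐ x ∂volume.restrict (rectSet R),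
      ENNReal.ofReal |truncLog δ ((u x).toReal + η) - truncLog δ M| ≤
        ENNReal.ofReal (δ / M) * (u x + ENNReal.ofReal η) + ENNReal.ofReal (δ * (K + 1)) := by
    filter_upwards [ae_restrict_of_ae hfin, ae_restrict_mem hR] with x hxu hx
    have h1 : I / V ≤ ENNReal.ofReal K * u x := by
      rw [ENNReal.div_le_iff hV0 hVt]
      exact (hA R x hx).trans_eq (by ring)
    have h2 : (I / V).toReal ≤ K * (u x).toReal := by
      have := ENNReal.toReal_mono (ENNReal.mul_ne_top ENNReal.ofReal_ne_top hxu.ne) h1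
      rwa [ENNReal.toReal_mul, ENNReal.toReal_ofReal hK] at this
    have h0 : 0 ≤ (u x).toReal := ENNReal.toReal_nonneg
    have h3 : M ≤ (K + 1) * ((u x).toReal + η) := by
      have := mul_nonneg hK hη.le
      rw [hM]
      linarith
    calc _ ≤ ENNReal.ofReal (δ * (((u x).toReal + η) / M + (K + 1))) :=
          ENNReal.ofReal_le_ofReal
            (abs_truncLog_sub_le hδ (by positivity) hMpos (by positivity) h3)
      _ = ENNReal.ofReal (δ / M * ((u x).toReal + η) + δ * (K + 1)) := by
          congr 1
          ring
      _ = _ := by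
          rw [ENNReal.ofReal_add (by positivity) (by positivity),
            ENNReal.ofReal_mul (by positivity), ENNReal.ofReal_add h0 hη.le,
            ENNReal.ofReal_toReal hxu.ne]
  have hosc : ∫⁻ x in rectSet R, ENNReal.ofReal
      |truncLog δ ((u x).toReal + η) - truncLog δ M| ≤ ENNReal.ofReal (δ * (K + 2)) * V := by
    calc _ ≤ ∫⁻ x in rectSet R, (ENNReal.ofReal (δ / M) * (u x + ENNReal.ofReal η) +
            ENNReal.ofReal (δ * (K + 1))) := lintegral_mono_ae hpt
      _ = ENNReal.ofReal (δ / M) * (I + ENNReal.ofReal η * V) +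
            ENNReal.ofReal (δ * (K + 1)) * V := by
          rw [lintegral_add_right _ measurable_const, lintegral_const_mul _ (by fun_prop),
            lintegral_add_right _ measurable_const, setLIntegral_const, setLIntegral_const]
      _ = ENNReal.ofReal (δ / M) * (ENNReal.ofReal M * V) + ENNReal.ofReal (δ * (K + 1)) * V := by
          rw [hM, ENNReal.ofReal_add ENNReal.toReal_nonneg hη.le, ENNReal.ofReal_toReal hIV,
            add_mul, ENNReal.div_mul_cancel hV0 hVt]
      _ = ENNReal.ofReal (δ * (K + 2)) * V := by
          rw [← mul_assoc, ← ENNReal.ofReal_mul (by positivity), div_mul_cancel₀ _ hMpos.ne',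
            ← add_mul, ← ENNReal.ofReal_add hδ.le (by positivity)]
          congr 2
          ring
  have hintegrable : Integrable (fun x => truncLog δ ((u x).toReal + η))
      (volume.restrict (rectSet R)) := by
    refine Integrable.of_bound (C := 1)
      ((measurable_truncLog δ).comp (hu.ennreal_toReal.add_const η)).aestronglyMeasurable
      (Eventually.of_forall fun x => ?_)
    have := truncLog_mem_Icc δ ((u x).toReal + η)
    rw [Real.norm_eq_abs, abs_of_nonneg this.1]
    exact this.2
  calc _ ≤ V⁻¹ * (2 * (ENNReal.ofReal (δ * (K + 2)) * V)) := by
        gcongr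
        exact (lintegral_sub_average_le hintegrable (truncLog δ M)).trans (by gcongr)
    _ = (V⁻¹ * V) * (2 * ENNReal.ofReal (δ * (K + 2))) := by ring
    _ = ENNReal.ofReal (2 * (K + 2) * δ) := by
        rw [ENNReal.inv_mul_cancel hV0 hVt, one_mul, ← ENNReal.ofReal_ofNat 2,
          ← ENNReal.ofReal_mul (by norm_num)]
        congr 1
        ring

lemma volume_truncLog_pos_le {α : Type*} [MeasurableSpace α] {μ : Measure α} {u : α → ℝ≥0∞}
    (hu : Measurable u) {δ : ℝ} (hδ : 0 < δ) :
    μ {x | 0 < truncLog δ ((u x).toReal + Real.exp (-(1 / δ)) / 2)} ≤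
      ENNReal.ofReal (4 * Real.exp (2 / δ)) * ∫⁻ x, u x ^ 2 ∂μ := by
  set e := Real.exp (-(1 / δ)) with he
  have hepos : 0 < e := Real.exp_pos _
  have he2 : 4 * Real.exp (2 / δ) = ((e / 2) ^ 2)⁻¹ := by
    rw [div_pow, inv_div, he, ← Real.exp_nat_mul,
      show 2 / δ = -(((2 : ℕ) : ℝ) * -(1 / δ)) by push_cast; ring, Real.exp_neg]
    ring
  have hsub : {x | 0 < truncLog δ ((u x).toReal + e / 2)} ⊆
      {x | ENNReal.ofReal ((e / 2) ^ 2) ≤ u x ^ 2} := by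
    intro x hx
    have h := exp_lt_of_truncLog_pos hδ (by positivity) hx
    have h2 : e / 2 ≤ (u x).toReal := by
      rw [← he] at h
      linarith
    change ENNReal.ofReal ((e / 2) ^ 2) ≤ u x ^ 2
    rw [ENNReal.ofReal_pow (by positivity)]
    gcongr
    exact ENNReal.ofReal_le_of_le_toReal h2
  have hpos : 0 < (e / 2) ^ 2 := by positivity
  rw [he2, ENNReal.ofReal_inv_of_pos hpos, mul_comm, ← div_eq_mul_inv]
  exact (measure_mono hsub).trans (meas_ge_le_lintegral_div (by fun_prop)
    (by rwa [Ne, ENNReal.ofReal_eq_zero, not_le]) ENNReal.ofReal_ne_top)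

end Oscillation

/-- there are constants `C₁, C₂ > 0` (depending only on the dimensions)
such that for every measurable `E` with `0 < |E| < ∞` and every `δ > 0` there is a
measurable `τ : ℝⁿ → [0,1]` with `τ = 1` a.e. on `E`, `‖τ‖_bmo ≤ C₁δ`, and
`|{τ > 0}| ≤ C₂ e^{2/δ} |E|`. -/
theorem statement7 {d : ℕ} (hd : 1 ≤ d) (n : Fin d → ℕ) (hn : ∀ i, 1 ≤ n i) :
    ∃ C₁ > (0 : ℝ), ∃ C₂ > (0 : ℝ),
      ∀ E : Set (ProductSpace n), MeasurableSet E → 0 < volume E → volume E < ⊤ →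
        ∀ δ > (0 : ℝ), ∃ τ : ProductSpace n → ℝ,
          Measurable τ ∧ (∀ x, τ x ∈ Set.Icc (0 : ℝ) 1) ∧
          (∀ᵐ x ∂(volume : Measure (ProductSpace n)), x ∈ E → τ x = 1) ∧
          bmo1 τ ≤ ENNReal.ofReal (C₁ * δ) ∧
          volume {x | 0 < τ x} ≤ ENNReal.ofReal (C₂ * Real.exp (2 / δ)) * volume E := by
  set A : ℝ≥0∞ := ((List.finRange d).map fun i => 8 * 5 ^ n i).prod with hA
  have hAt : A ≠ ⊤ := by
    rw [hA, ← List.prod_toFinset _ (List.nodup_finRange d)]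
    exact ENNReal.prod_ne_top fun i _ => ENNReal.mul_ne_top (by norm_num)
      (ENNReal.pow_ne_top (by norm_num))
  set B : ℝ≥0∞ := (∏ i, 4 ^ n i) * (8 * (A + 1)) with hB
  have hBt : B ≠ ⊤ := ENNReal.mul_ne_top
    (ENNReal.prod_ne_top fun i _ => ENNReal.pow_ne_top (by norm_num))
    (ENNReal.mul_ne_top (by norm_num) (by simp [hAt]))
  refine ⟨2 * (B.toReal + 2), by positivity, 32, by norm_num, fun E hE _ hEt δ hδ => ?_⟩
  have hone : Measurable (E.indicator fun _ => (1 : ℝ≥0∞)) := measurable_const.indicator hE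
  obtain ⟨u, hu, hEu, hTu, hu2⟩ := exists_majorant_of_sublinear (μ := volume)
    (T := iterMaximal (n := n) (List.finRange d))
    (fun f hf => measurable_iterMaximal _ hf) (fun c f hf => iterMaximal_const_mul _ c hf)
    (fun f hf x => iterMaximal_tsum_le _ hf x) hAt
    (fun f hf => lintegral_iterMaximal_sq_le _ hf) hone
  have hE2 : ∫⁻ x, (E.indicator fun _ => (1 : ℝ≥0∞)) x ^ 2 = volume E := by
    rw [← lintegral_indicator_one hE]
    refine lintegral_congr fun x => ?_
    by_cases hx : x ∈ E <;> simp [hx]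
  rw [hE2] at hu2
  have hfin : ∀ᵐ x, u x < ⊤ := by
    filter_upwards [ae_lt_top (hu.pow_const 2)
      (ne_top_of_le_ne_top (ENNReal.mul_ne_top (by norm_num) hEt.ne) hu2)] with x hx
    exact lt_top_iff_ne_top.2 fun h => by simp [h] at hx
  refine ⟨fun x => truncLog δ ((u x).toReal + Real.exp (-(1 / δ)) / 2),
    (measurable_truncLog δ).comp (hu.ennreal_toReal.add_const _),
    fun x => truncLog_mem_Icc _ _, ?_, ?_, ?_⟩
  · filter_upwards [hfin] with x hx hxE
    have h1 : 1 ≤ u x := by simpa [hxE] using hEu x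
    have h2 : 1 ≤ (u x).toReal := by
      simpa using ENNReal.toReal_mono hx.ne h1
    exact truncLog_eq_one hδ.le (by linarith [Real.exp_pos (-(1 / δ))])
  · refine bmo1_truncLog_le hu hfin ENNReal.toReal_nonneg (fun R x hx => ?_) hδ (by positivity)
    rw [ENNReal.ofReal_toReal hBt]
    calc _ ≤ (∏ i, 4 ^ n i) * volume (rectSet R) * iterMaximal (List.finRange d) u x :=
          setLIntegral_rectSet_le_iterMaximal hu R hx
      _ ≤ (∏ i, 4 ^ n i) * volume (rectSet R) * (8 * (A + 1) * u x) := by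
          gcongr
          exact hTu x
      _ = _ := by
          rw [hB]
          ring
  · calc _ ≤ ENNReal.ofReal (4 * Real.exp (2 / δ)) * (8 * volume E) :=
          (volume_truncLog_pos_le hu hδ).trans (by gcongr)
      _ = _ := by
          rw [← mul_assoc, ← ENNReal.ofReal_ofNat 8, ← ENNReal.ofReal_mul (by positivity)]
          congr 2
          ring
end

section
/- Let d ≥ 1, n₁,…,n_d ≥ 1, n = n₁+…+n_d. There is a constant C depending only on n₁,…,n_d such that for every f ∈ L¹(ℝⁿ), ‖f‖_{L¹} ≤ C‖S f‖_{L¹} (the L¹ norm is controlled by the dyadic product H¹ norm). -/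
open MeasureTheory ENNReal Filter

section path

theorem sqrt_square_increment_le {q X D t : ℝ} (hq : 0 ≤ q) (hX : 0 ≤ X) (hD : 0 ≤ D)
    (ht : |t| ≤ X * D) :
    √(q + D ^ 2 + (X ^ 2 + 2 * t + D ^ 2)) ≤
      √(q + X ^ 2) + t / √(q + X ^ 2) + 8 * (√(q + D ^ 2) - √q) := by
  obtain ⟨ht1, ht2⟩ := abs_le.1 ht
  have hs0 : 0 ≤ √q := Real.sqrt_nonneg _
  have hA0 : 0 ≤ √(q + X ^ 2) := Real.sqrt_nonneg _
  have hr0 : 0 ≤ √(q + D ^ 2) := Real.sqrt_nonneg _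
  have hs2 : √q ^ 2 = q := Real.sq_sqrt hq
  have hA2 : √(q + X ^ 2) ^ 2 = q + X ^ 2 := Real.sq_sqrt (by positivity)
  have hr2 : √(q + D ^ 2) ^ 2 = q + D ^ 2 := Real.sq_sqrt (by positivity)
  generalize √q = s at *
  generalize √(q + X ^ 2) = A at *
  generalize √(q + D ^ 2) = r at *
  have hsr : s ≤ r := by nlinarith
  have hsA : s ≤ A := by nlinarith
  have hXA : X ≤ A := by nlinarith
  rcases hA0.eq_or_lt with hA | hA
  · subst hA
    have hX' : X = 0 := by linarith
    have hq' : q = 0 := by nlinarith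
    have hs' : s = 0 := by linarith
    subst hX' hq' hs'
    have ht' : t = 0 := by linarith
    subst ht'
    have hrD : D ≤ r := by nlinarith
    refine Real.sqrt_le_iff.2 ⟨by simp; linarith, ?_⟩
    norm_num
    nlinarith
  have htA : -D ≤ t / A := by
    rw [le_div_iff₀ hA]
    nlinarith [mul_le_mul_of_nonneg_right hXA hD]
  rcases le_total D s with h | h
  · have hDr : D ^ 2 / A ≤ 8 * (r - s) := by
      rw [div_le_iff₀ hA]
      have hr : r ≤ 2 * s := by nlinarith
      nlinarith [mul_nonneg (sub_nonneg.2 hsr) (sub_nonneg.2 hsA)]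
    refine le_trans (Real.sqrt_le_iff.2 ⟨?_, ?_⟩)
      (show A + t / A + D ^ 2 / A ≤ _ by linarith)
    · have : A + t / A + D ^ 2 / A = (A ^ 2 + t + D ^ 2) / A := by field_simp
      rw [this]
      apply div_nonneg _ hA.le
      nlinarith [sq_nonneg (X - D)]
    · have h1 : A + t / A + D ^ 2 / A = A + (t + D ^ 2) / A := by ring
      have h2 : A * ((t + D ^ 2) / A) = t + D ^ 2 := by field_simp
      rw [h1]
      nlinarith [sq_nonneg ((t + D ^ 2) / A)]
  · have h3 : 3 * D ≤ 8 * (r - s) := by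
      have : 3 * D + 8 * s ≤ 8 * r := by
        refine (sq_le_sq₀ (by positivity) (by positivity)).1 ?_
        nlinarith [mul_nonneg hD (sub_nonneg.2 h), mul_nonneg hs0 hD]
      linarith
    refine le_trans (Real.sqrt_le_iff.2 ⟨?_, ?_⟩) (show A + 2 * D ≤ _ by linarith)
    · positivity
    · nlinarith [mul_le_mul_of_nonneg_right hXA hD]

variable {H : Type*} [NormedAddCommGroup H]

/-- The quadratic variation of a path up to time `j`. -/
noncomputable def quadVar (v : ℕ → H) (j : ℕ) : ℝ :=
  ∑ i ∈ Finset.range j, ‖v (i + 1) - v i‖ ^ 2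

theorem quadVar_nonneg (v : ℕ → H) (j : ℕ) : 0 ≤ quadVar v j :=
  Finset.sum_nonneg fun _ _ => sq_nonneg _

variable [InnerProductSpace ℝ H]

/-- The integrand in the pathwise Davis inequality. -/
noncomputable def davisWeight (v : ℕ → H) (j : ℕ) : H :=
  (√(quadVar v j + ‖v j‖ ^ 2))⁻¹ • v j

theorem norm_davisWeight_le (v : ℕ → H) (j : ℕ) : ‖davisWeight v j‖ ≤ 1 := by
  rw [davisWeight, norm_smul, norm_inv, Real.norm_of_nonneg (Real.sqrt_nonneg _)]
  apply inv_mul_le_one_of_le₀ _ (Real.sqrt_nonneg _)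
  exact Real.le_sqrt_of_sq_le (by linarith [quadVar_nonneg v j])

/-- Pathwise Davis inequality for paths in an inner product space. -/
theorem norm_le_quadVar_add_sum (v : ℕ → H) (h0 : v 0 = 0) (j : ℕ) :
    ‖v j‖ ≤ 8 * √(quadVar v j) +
      ∑ i ∈ Finset.range j, inner ℝ (davisWeight v i) (v (i + 1) - v i) := by
  have key : √(quadVar v j + ‖v j‖ ^ 2) ≤ 8 * √(quadVar v j) +
      ∑ i ∈ Finset.range j, inner ℝ (davisWeight v i) (v (i + 1) - v i) := by
    induction j with
    | zero => simp [quadVar, h0]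
    | succ j ih =>
      rw [Finset.sum_range_succ]
      have hq : quadVar v (j + 1) = quadVar v j + ‖v (j + 1) - v j‖ ^ 2 :=
        Finset.sum_range_succ _ _
      have hn : ‖v (j + 1)‖ ^ 2 = ‖v j‖ ^ 2 + 2 * inner ℝ (v j) (v (j + 1) - v j)
          + ‖v (j + 1) - v j‖ ^ 2 := by
        rw [← norm_add_sq_real, add_sub_cancel]
      have hs := sqrt_square_increment_le (quadVar_nonneg v j) (norm_nonneg (v j))
        (norm_nonneg (v (j + 1) - v j)) (abs_real_inner_le_norm _ _)
      rw [← hq, ← hn] at hs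
      have hi : inner ℝ (davisWeight v j) (v (j + 1) - v j) =
          inner ℝ (v j) (v (j + 1) - v j) / √(quadVar v j + ‖v j‖ ^ 2) := by
        rw [davisWeight, real_inner_smul_left, inv_mul_eq_div]
      rw [hi]
      linarith
  exact (Real.le_sqrt_of_sq_le (by linarith [quadVar_nonneg v j])).trans key

end path
section cubes

variable {m : ℕ}

theorem mem_dyadicCubeSet_iff (c : DyadicCube m) (x : Fin m → ℝ) :
    x ∈ dyadicCubeSet c ↔ dyadicCubeOf c.k x = c := by
  have h2 : (0 : ℝ) < 2 ^ c.k := by positivity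
  obtain ⟨k, j⟩ := c
  simp only [dyadicCubeSet, dyadicCubeOf, Set.mem_ofPred_eq, DyadicCube.mk.injEq, true_and,
    funext_iff, Int.floor_eq_iff, le_div_iff₀ h2, div_lt_iff₀ h2]

theorem dyadicCubeOf_succ_eq {k : ℤ} {x y : Fin m → ℝ}
    (h : dyadicCubeOf k x = dyadicCubeOf k y) :
    dyadicCubeOf (k + 1) x = dyadicCubeOf (k + 1) y := by
  simp only [dyadicCubeOf, DyadicCube.mk.injEq, true_and, funext_iff] at h ⊢
  intro i
  have key (a : ℝ) : ⌊a / 2 ^ (k + 1)⌋ = ⌊a / 2 ^ k⌋ / (2 : ℕ) := by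
    rw [← Int.floor_div_natCast, zpow_add_one₀ two_ne_zero, div_div]
    norm_num
  rw [key, key, h i]

theorem dyadicCubeOf_eq_of_le {k l : ℤ} (hkl : k ≤ l) {x y : Fin m → ℝ}
    (h : dyadicCubeOf k x = dyadicCubeOf k y) :
    dyadicCubeOf l x = dyadicCubeOf l y := by
  induction l, hkl using Int.leInduction with
  | base => exact h
  | succ l _ ih => exact dyadicCubeOf_succ_eq ih

theorem dyadicCubeSet_eq_pi (c : DyadicCube m) : dyadicCubeSet c =
    Set.univ.pi fun i => Set.Ico ((c.j i : ℝ) * 2 ^ c.k) (((c.j i : ℝ) + 1) * 2 ^ c.k) := by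
  ext x
  simp [dyadicCubeSet]

theorem measurableSet_dyadicCubeSet (c : DyadicCube m) : MeasurableSet (dyadicCubeSet c) := by
  rw [dyadicCubeSet_eq_pi]
  exact MeasurableSet.univ_pi fun _ => measurableSet_Ico

theorem volume_dyadicCubeSet (c : DyadicCube m) :
    volume (dyadicCubeSet c) = ENNReal.ofReal ((2 ^ c.k) ^ m) := by
  rw [dyadicCubeSet_eq_pi, Real.volume_pi_Ico, ← ENNReal.ofReal_prod_of_nonneg]
  · congr 1
    simp [← sub_mul]
  · intro i _
    rw [← sub_mul]
    norm_num
    positivity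

/-- Pairs of points lying in the same cube of generation `k`. -/
def sameCube (m : ℕ) (k : ℤ) : Set ((Fin m → ℝ) × (Fin m → ℝ)) :=
  {p | dyadicCubeOf k p.1 = dyadicCubeOf k p.2}

theorem measurableSet_sameCube (k : ℤ) : MeasurableSet (sameCube m k) := by
  have : sameCube m k = ⋂ i, {p | ⌊p.1 i / (2 : ℝ) ^ k⌋ = ⌊p.2 i / (2 : ℝ) ^ k⌋} := by
    ext p
    simp [sameCube, dyadicCubeOf, funext_iff]
  rw [this]
  refine MeasurableSet.iInter fun i => measurableSet_eq_fun ?_ ?_ <;> fun_prop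

theorem mem_sameCube {k : ℤ} {x y : Fin m → ℝ} :
    (x, y) ∈ sameCube m k ↔ dyadicCubeOf k x = dyadicCubeOf k y :=
  Iff.rfl

/-- The averaging kernel of `E_k`. -/
noncomputable def avgKernel (k : ℤ) (x y : Fin m → ℝ) : ℝ :=
  (sameCube m k).indicator (fun _ => ((2 ^ k) ^ m)⁻¹) (x, y)

theorem measurable_avgKernel (k : ℤ) :
    Measurable (fun p : (Fin m → ℝ) × (Fin m → ℝ) => avgKernel k p.1 p.2) :=
  measurable_const.indicator (measurableSet_sameCube k)

theorem avgKernel_symm (k : ℤ) (x y : Fin m → ℝ) : avgKernel k x y = avgKernel k y x := by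
  by_cases h : dyadicCubeOf k x = dyadicCubeOf k y
  · simp [avgKernel, mem_sameCube, h]
  · simp [avgKernel, mem_sameCube, h, Ne.symm h]

theorem avgKernel_eq_indicator (k : ℤ) (x y : Fin m → ℝ) : avgKernel k x y =
    (dyadicCubeSet (dyadicCubeOf k x)).indicator (fun _ => ((2 ^ k) ^ m)⁻¹) y := by
  have : y ∈ dyadicCubeSet (dyadicCubeOf k x) ↔ dyadicCubeOf k x = dyadicCubeOf k y := by
    rw [mem_dyadicCubeSet_iff, eq_comm]; rfl
  by_cases h : dyadicCubeOf k x = dyadicCubeOf k y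
  · rw [avgKernel, Set.indicator_of_mem (mem_sameCube.2 h), Set.indicator_of_mem (this.2 h)]
  · rw [avgKernel, Set.indicator_of_notMem (mt mem_sameCube.1 h),
      Set.indicator_of_notMem (mt this.1 h)]

theorem Ek_eq_integral (k : ℤ) (f : (Fin m → ℝ) → ℝ) (x : Fin m → ℝ) :
    Ek k f x = ∫ y, avgKernel k x y * f y := by
  have h2 : (0 : ℝ) ≤ (2 ^ k) ^ m := by positivity
  have h (y) : avgKernel k x y * f y = ((2 ^ k) ^ m)⁻¹ *
      (dyadicCubeSet (dyadicCubeOf k x)).indicator f y := by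
    rw [avgKernel_eq_indicator]
    simp only [Set.indicator]
    split_ifs <;> simp
  simp only [h]
  rw [integral_const_mul, integral_indicator (measurableSet_dyadicCubeSet _), Ek,
    setAverage_eq, Measure.real, volume_dyadicCubeSet]
  change (ENNReal.ofReal ((2 ^ k) ^ m)).toReal⁻¹ • _ = _
  rw [ENNReal.toReal_ofReal h2, smul_eq_mul]

theorem lintegral_avgKernel (k : ℤ) (x : Fin m → ℝ) : ∫⁻ y, ‖avgKernel k x y‖ₑ = 1 := by
  have h2 : (0 : ℝ) < (2 ^ k) ^ m := by positivity
  simp only [avgKernel_eq_indicator, enorm_indicator_eq_indicator_enorm]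
  rw [lintegral_indicator (measurableSet_dyadicCubeSet _), setLIntegral_const,
    volume_dyadicCubeSet, Real.enorm_of_nonneg (by positivity), ← ENNReal.ofReal_mul (by positivity)]
  change ENNReal.ofReal (((2 ^ k) ^ m)⁻¹ * (2 ^ k) ^ m) = 1
  rw [inv_mul_cancel₀ h2.ne', ENNReal.ofReal_one]

theorem Ek_eq_of_dyadicCubeOf_eq {k : ℤ} (f : (Fin m → ℝ) → ℝ) {x y : Fin m → ℝ}
    (h : dyadicCubeOf k x = dyadicCubeOf k y) : Ek k f x = Ek k f y := by
  rw [Ek, Ek, h]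

theorem Ek_congr_ae {f g : (Fin m → ℝ) → ℝ} (h : f =ᵐ[volume] g) (k : ℤ) : Ek k f = Ek k g := by
  ext x
  exact average_congr (ae_restrict_of_ae h)

theorem deltaQ_congr_ae {f g : (Fin m → ℝ) → ℝ} (h : f =ᵐ[volume] g) (c : DyadicCube m) :
    deltaQ c f = deltaQ c g := by
  rw [deltaQ, deltaQ, Ek_congr_ae h, Ek_congr_ae h]

theorem measurable_Ek {f : (Fin m → ℝ) → ℝ} (hf : Measurable f) (k : ℤ) :
    Measurable (Ek k f) := by
  have : Ek k f = fun x => ∫ y, avgKernel k x y * f y := funext (Ek_eq_integral k f)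
  rw [this]
  refine (StronglyMeasurable.integral_prod_right (f := fun x y => avgKernel k x y * f y)
    (Measurable.stronglyMeasurable ?_)).measurable
  exact (measurable_avgKernel k).mul (hf.comp measurable_snd)

theorem lintegral_avgKernel_mul {g : (Fin m → ℝ) → ℝ} (hg : Measurable g) (k : ℤ) :
    ∫⁻ x, ∫⁻ y, ‖avgKernel k x y * g y‖ₑ = ∫⁻ y, ‖g y‖ₑ := by
  rw [lintegral_lintegral_swap]
  · congr 1 with y
    simp only [enorm_mul]
    rw [lintegral_mul_const]
    · simp only [avgKernel_symm k _ y]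
      rw [lintegral_avgKernel, one_mul]
    · exact ((measurable_avgKernel k).comp (measurable_id.prodMk measurable_const)).enorm
  · exact ((measurable_avgKernel k).mul (hg.comp measurable_snd)).enorm.aemeasurable

theorem lintegral_enorm_Ek_le {g : (Fin m → ℝ) → ℝ} (hg : Measurable g) (k : ℤ) :
    ∫⁻ x, ‖Ek k g x‖ₑ ≤ ∫⁻ y, ‖g y‖ₑ := by
  rw [← lintegral_avgKernel_mul hg k]
  refine lintegral_mono fun x => ?_
  rw [Ek_eq_integral]
  exact enorm_integral_le_lintegral_enorm _

theorem integrable_Ek {g : (Fin m → ℝ) → ℝ} (hg : Measurable g) (hi : Integrable g) (k : ℤ) :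
    Integrable (Ek k g) :=
  ⟨(measurable_Ek hg k).aestronglyMeasurable, (lintegral_enorm_Ek_le hg k).trans_lt hi.2⟩

theorem lintegral_enorm_deltaQ_le {g : (Fin m → ℝ) → ℝ} (hg : Measurable g)
    (c : DyadicCube m) : ∫⁻ x, ‖deltaQ c g x‖ₑ ≤ 2 * ∫⁻ y, ‖g y‖ₑ := by
  calc ∫⁻ x, ‖deltaQ c g x‖ₑ ≤ ∫⁻ x, (‖Ek (c.k - 1) g x‖ₑ + ‖Ek c.k g x‖ₑ) := by
        refine lintegral_mono fun x => ?_
        rw [deltaQ, enorm_indicator_eq_indicator_enorm]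
        exact (Set.indicator_le_self _ _ _).trans enorm_sub_le
    _ = (∫⁻ x, ‖Ek (c.k - 1) g x‖ₑ) + ∫⁻ x, ‖Ek c.k g x‖ₑ :=
        lintegral_add_left (measurable_Ek hg _).enorm _
    _ ≤ 2 * ∫⁻ y, ‖g y‖ₑ := by
        rw [two_mul]
        exact add_le_add (lintegral_enorm_Ek_le hg _) (lintegral_enorm_Ek_le hg _)

theorem integral_mul_Ek {g h : (Fin m → ℝ) → ℝ} (hg : Measurable g) (hi : Integrable g)
    (hh : Measurable h) (hb : ∀ x, |h x| ≤ 1) {k : ℤ}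
    (hk : ∀ x y, dyadicCubeOf k x = dyadicCubeOf k y → h x = h y) :
    ∫ x, h x * Ek k g x = ∫ x, h x * g x := by
  have hkK (x y) : h x * (avgKernel k x y * g y) = avgKernel k y x * (h y * g y) := by
    rw [avgKernel_symm k y x]
    by_cases hxy : dyadicCubeOf k x = dyadicCubeOf k y
    · rw [hk x y hxy]; ring
    · simp [avgKernel, mem_sameCube, hxy]
  have hmeas : Measurable (fun p : (Fin m → ℝ) × (Fin m → ℝ) =>
      h p.1 * (avgKernel k p.1 p.2 * g p.2)) :=
    (hh.comp measurable_fst).mul ((measurable_avgKernel k).mul (hg.comp measurable_snd))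
  have hint : Integrable (fun p : (Fin m → ℝ) × (Fin m → ℝ) =>
      h p.1 * (avgKernel k p.1 p.2 * g p.2)) (volume.prod volume) := by
    refine ⟨hmeas.aestronglyMeasurable, ?_⟩
    rw [HasFiniteIntegral, lintegral_prod _ hmeas.enorm.aemeasurable]
    refine lt_of_le_of_lt ?_ hi.2
    rw [← lintegral_avgKernel_mul hg k]
    refine lintegral_mono fun x => lintegral_mono fun y => ?_
    rw [enorm_mul (h x)]
    refine mul_le_of_le_one_left' ?_
    rw [← ofReal_norm, Real.norm_eq_abs]
    simpa using ENNReal.ofReal_le_ofReal (hb x)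
  simp only [Ek_eq_integral, ← integral_const_mul]
  rw [integral_integral_swap hint]
  congr 1 with y
  simp only [hkK]
  rw [integral_mul_const]
  have h1 : ∫ x, avgKernel k y x = 1 := by
    have h0 : 0 ≤ᵐ[volume] fun x => avgKernel k y x :=
      Eventually.of_forall fun x => Set.indicator_nonneg (fun _ _ => by positivity) _
    have hm : Measurable fun x => avgKernel k y x :=
      (measurable_avgKernel k).comp (measurable_const.prodMk measurable_id)
    rw [integral_eq_lintegral_of_nonneg_ae h0 hm.aestronglyMeasurable]
    have := lintegral_avgKernel k y
    rw [← ENNReal.toReal_one, ← this]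
    congr 1
    refine lintegral_congr_ae ?_
    filter_upwards [h0] with x hx
    rw [Real.enorm_of_nonneg hx]
  rw [h1, one_mul]

theorem tendsto_Ek_atBot_generation {g : (Fin m → ℝ) → ℝ} (hi : Integrable g) :
    ∀ᵐ x, Tendsto (fun N : ℕ => Ek (-(N : ℤ)) g x) atTop (nhds (g x)) := by
  filter_upwards [IsUnifLocDoublingMeasure.ae_tendsto_average (μ := volume)
    hi.locallyIntegrable 1] with x hx
  have hδ : Tendsto (fun N : ℕ => (2 : ℝ) ^ (-(N : ℤ)) / 2) atTop (nhdsWithin 0 (Set.Ioi 0)) := by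
    refine tendsto_nhdsWithin_iff.2 ⟨?_, Eventually.of_forall fun N => ?_⟩
    · have := (tendsto_pow_atTop_nhds_zero_of_lt_one (r := (1 / 2 : ℝ))
        (by norm_num) (by norm_num)).div_const 2
      simpa [zpow_neg] using this
    · have : (0 : ℝ) < 2 ^ (-(N : ℤ)) := by positivity
      exact half_pos this
  have hc (N : ℕ) : dyadicCubeSet (dyadicCubeOf (-(N : ℤ)) x) ⊆ Metric.closedBall
      (fun i => ((⌊x i / 2 ^ (-(N : ℤ))⌋ : ℝ) + 1 / 2) * 2 ^ (-(N : ℤ)))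
      ((2 : ℝ) ^ (-(N : ℤ)) / 2) := by
    intro y hy
    rw [Metric.mem_closedBall, dist_pi_le_iff (by positivity)]
    intro i
    have := hy i
    simp only [dyadicCubeOf] at this
    rw [Real.dist_eq, abs_le]
    constructor <;> linarith
  have := hx _ _ hδ (Eventually.of_forall fun N => by
    rw [one_mul]
    exact hc N ((mem_dyadicCubeSet_iff _ _).2 rfl))
  refine this.congr fun N => ?_
  refine (setAverage_congr ?_).symm
  refine ae_eq_of_subset_of_measure_ge (hc N) (le_of_eq ?_)
    (measurableSet_dyadicCubeSet _).nullMeasurableSet ?_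
  · rw [volume_dyadicCubeSet, Real.volume_pi_closedBall _ (by positivity)]
    simp [dyadicCubeOf, mul_div_cancel₀]
  · rw [Real.volume_pi_closedBall _ (by positivity)]
    exact ENNReal.ofReal_ne_top

theorem tendsto_Ek_atTop_generation (hm : 1 ≤ m) {g : (Fin m → ℝ) → ℝ} (hi : Integrable g)
    (x : Fin m → ℝ) :
    Tendsto (fun N : ℕ => Ek (N : ℤ) g x) atTop (nhds 0) := by
  have hlim : Tendsto (fun N : ℕ => (1 / 2 : ℝ) ^ N * ∫ y, ‖g y‖) atTop (nhds 0) := by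
    simpa using (tendsto_pow_atTop_nhds_zero_of_lt_one (r := (1 / 2 : ℝ))
        (by norm_num) (by norm_num)).mul_const (∫ y, ‖g y‖)
  refine squeeze_zero_norm (fun N => ?_) hlim
  rw [Ek_eq_integral, ← integral_const_mul]
  refine norm_integral_le_of_norm_le (hi.norm.const_mul _) (Eventually.of_forall fun y => ?_)
  rw [norm_mul]
  refine mul_le_mul_of_nonneg_right ?_ (norm_nonneg _)
  have h2 : (1 : ℝ) ≤ 2 ^ N := one_le_pow₀ (by norm_num)
  have h3 : ‖avgKernel (N : ℤ) x y‖ ≤ ((2 ^ N) ^ m : ℝ)⁻¹ := by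
    rw [avgKernel]
    refine (norm_indicator_le_norm_self _ _).trans ?_
    simp
  refine h3.trans ?_
  rw [one_div, inv_pow]
  exact inv_anti₀ (by positivity) (le_self_pow₀ h2 (by omega))

end cubes
section oneParameter

variable {m : ℕ} {ι : Type*}

/-- The martingale path at `y` of a family of functions, started from zero at generation `N`. -/
noncomputable def martPath (g : ι → (Fin m → ℝ) → ℝ) (N : ℤ) (y : Fin m → ℝ) (j : ℕ) :
    EuclideanSpace ℝ ι :=
  WithLp.toLp 2 fun a => Ek (N - j) (g a) y - Ek N (g a) y

theorem martPath_zero (g : ι → (Fin m → ℝ) → ℝ) (N : ℤ) (y : Fin m → ℝ) :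
    martPath g N y 0 = 0 := by
  ext a
  simp [martPath]

theorem martPath_sub (g : ι → (Fin m → ℝ) → ℝ) (N : ℤ) (y : Fin m → ℝ) (j : ℕ) (a : ι) :
    (martPath g N y (j + 1) - martPath g N y j) a =
      Ek (N - j - 1) (g a) y - Ek (N - j) (g a) y := by
  simp [martPath, sub_sub]

theorem martPath_eq {g : ι → (Fin m → ℝ) → ℝ} {N : ℤ} {x y : Fin m → ℝ} {j : ℕ}
    (h : dyadicCubeOf (N - j) x = dyadicCubeOf (N - j) y) {i : ℕ} (hi : i ≤ j) :
    martPath g N x i = martPath g N y i := by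
  ext a
  simp only [martPath]
  rw [Ek_eq_of_dyadicCubeOf_eq _ (dyadicCubeOf_eq_of_le (by omega) h),
    Ek_eq_of_dyadicCubeOf_eq _ (dyadicCubeOf_eq_of_le (l := N) (by omega) h)]

variable [Fintype ι]

theorem davisWeight_martPath_eq {g : ι → (Fin m → ℝ) → ℝ} {N : ℤ} {x y : Fin m → ℝ} {j : ℕ}
    (h : dyadicCubeOf (N - j) x = dyadicCubeOf (N - j) y) :
    davisWeight (martPath g N x) j = davisWeight (martPath g N y) j := by
  have hq : quadVar (martPath g N x) j = quadVar (martPath g N y) j := by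
    refine Finset.sum_congr rfl fun i hi => ?_
    have := Finset.mem_range.1 hi
    rw [martPath_eq h (by omega : i + 1 ≤ j), martPath_eq h (by omega : i ≤ j)]
  rw [davisWeight, davisWeight, hq, martPath_eq h le_rfl]

variable {g : ι → (Fin m → ℝ) → ℝ}

theorem measurable_martPath (hg : ∀ a, Measurable (g a)) (N : ℤ) (j : ℕ) :
    Measurable fun y => martPath g N y j := by
  refine (PiLp.continuous_toLp 2 _).measurable.comp (measurable_pi_lambda _ fun a => ?_)
  exact (measurable_Ek (hg a) _).sub (measurable_Ek (hg a) _)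

theorem measurable_quadVar_martPath (hg : ∀ a, Measurable (g a)) (N : ℤ) (j : ℕ) :
    Measurable fun y => quadVar (martPath g N y) j :=
  Finset.measurable_sum _ fun i _ =>
    (((measurable_martPath hg N (i + 1)).sub (measurable_martPath hg N i)).norm).pow_const 2

theorem measurable_davisWeight_martPath (hg : ∀ a, Measurable (g a)) (N : ℤ) (j : ℕ) :
    Measurable fun y => davisWeight (martPath g N y) j := by
  unfold davisWeight
  exact (((measurable_quadVar_martPath hg N j).add
    ((measurable_martPath hg N j).norm.pow_const 2)).sqrt.inv).smul (measurable_martPath hg N j)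

theorem integrable_martPath (hg : ∀ a, Measurable (g a)) (hi : ∀ a, Integrable (g a))
    (N : ℤ) (j : ℕ) : Integrable fun y => martPath g N y j := by
  have h : Integrable fun y => ∑ a, ‖(martPath g N y j) a‖ :=
    integrable_finsetSum _ fun a _ =>
      ((integrable_Ek (hg a) (hi a) _).sub (integrable_Ek (hg a) (hi a) _)).norm
  refine h.mono' (measurable_martPath hg N j).aestronglyMeasurable (Eventually.of_forall fun y => ?_)
  rw [EuclideanSpace.norm_eq]
  refine Real.sqrt_le_iff.2 ⟨by positivity, ?_⟩
  exact Finset.sum_sq_le_sq_sum_of_nonneg fun _ _ => norm_nonneg _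

theorem integrable_sqrt_quadVar_martPath (hg : ∀ a, Measurable (g a))
    (hi : ∀ a, Integrable (g a)) (N : ℤ) (j : ℕ) :
    Integrable fun y => √(quadVar (martPath g N y) j) := by
  have h : Integrable fun y => ∑ i ∈ Finset.range j,
      ‖martPath g N y (i + 1) - martPath g N y i‖ :=
    integrable_finsetSum _ fun i _ =>
      ((integrable_martPath hg hi N (i + 1)).sub (integrable_martPath hg hi N i)).norm
  refine h.mono' (measurable_quadVar_martPath hg N j).sqrt.aestronglyMeasurable
    (Eventually.of_forall fun y => ?_)
  rw [Real.norm_of_nonneg (Real.sqrt_nonneg _)]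
  refine Real.sqrt_le_iff.2 ⟨by positivity, ?_⟩
  exact Finset.sum_sq_le_sq_sum_of_nonneg fun _ _ => norm_nonneg _

theorem integrable_davisWeight_inner (hg : ∀ a, Measurable (g a))
    (hi : ∀ a, Integrable (g a)) (N : ℤ) (j : ℕ) :
    Integrable fun y => inner ℝ (davisWeight (martPath g N y) j)
      (martPath g N y (j + 1) - martPath g N y j) := by
  have h := ((integrable_martPath hg hi N (j + 1)).sub (integrable_martPath hg hi N j))
  refine h.norm.mono' ((measurable_davisWeight_martPath hg N j).inner
    ((measurable_martPath hg N (j + 1)).sub (measurable_martPath hg N j))).aestronglyMeasurable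
    (Eventually.of_forall fun y => ?_)
  refine (norm_inner_le_norm _ _).trans ?_
  exact mul_le_of_le_one_left (norm_nonneg _) (norm_davisWeight_le _ _)

theorem integral_davisWeight_inner (hg : ∀ a, Measurable (g a))
    (hi : ∀ a, Integrable (g a)) (N : ℤ) (j : ℕ) :
    ∫ y, inner ℝ (davisWeight (martPath g N y) j)
      (martPath g N y (j + 1) - martPath g N y j) = 0 := by
  set w : ι → (Fin m → ℝ) → ℝ := fun a y => davisWeight (martPath g N y) j a with hw
  have hwm (a) : Measurable (w a) :=
    (measurable_pi_apply a).comp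
      ((PiLp.continuous_ofLp 2 _).measurable.comp (measurable_davisWeight_martPath hg N j))
  have hwb (a y) : |w a y| ≤ 1 :=
    (PiLp.norm_apply_le (davisWeight (martPath g N y) j) a).trans (norm_davisWeight_le _ _)
  have hwc (a x y) (h : dyadicCubeOf (N - j) x = dyadicCubeOf (N - j) y) : w a x = w a y := by
    simp only [hw, davisWeight_martPath_eq h]
  have hint (a k) : Integrable fun y => w a y * Ek k (g a) y :=
    (integrable_Ek (hg a) (hi a) k).bdd_mul (c := 1) (hwm a).aestronglyMeasurable
      (Eventually.of_forall (hwb a))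
  have heq (y) : inner ℝ (davisWeight (martPath g N y) j)
      (martPath g N y (j + 1) - martPath g N y j) =
      ∑ a, (w a y * Ek (N - j - 1) (g a) y - w a y * Ek (N - j) (g a) y) := by
    rw [PiLp.inner_apply]
    refine Finset.sum_congr rfl fun a _ => ?_
    rw [martPath_sub, ← mul_sub, mul_comm]
    rfl
  simp only [heq]
  have hsub (a) : Integrable fun y =>
      w a y * Ek (N - j - 1) (g a) y - w a y * Ek (N - j) (g a) y := (hint a _).sub (hint a _)
  rw [integral_finsetSum _ fun a _ => hsub a]
  refine Finset.sum_eq_zero fun a _ => ?_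
  rw [integral_sub (hint a _) (hint a _),
    integral_mul_Ek (hg a) (hi a) (hwm a) (hwb a) (hwc a),
    integral_mul_Ek (hg a) (hi a) (hwm a) (hwb a), sub_self]
  intro x y h
  have := dyadicCubeOf_succ_eq h
  rw [sub_add_cancel] at this
  exact hwc a x y this

theorem integral_norm_martPath_le (hg : ∀ a, Measurable (g a)) (hi : ∀ a, Integrable (g a))
    (N : ℤ) (j : ℕ) :
    ∫ y, ‖martPath g N y j‖ ≤ 8 * ∫ y, √(quadVar (martPath g N y) j) := by
  have hq := (integrable_sqrt_quadVar_martPath hg hi N j).const_mul 8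
  have hs := integrable_finsetSum (Finset.range j)
    fun i _ => integrable_davisWeight_inner hg hi N i
  have := integral_mono (integrable_martPath hg hi N j).norm (hq.add hs)
    fun y => norm_le_quadVar_add_sum _ (martPath_zero g N y) j
  refine this.trans (le_of_eq ?_)
  simp only [Pi.add_apply]
  rw [integral_add hq hs, integral_const_mul,
    integral_finsetSum _ fun i _ => integrable_davisWeight_inner hg hi N i]
  simp [integral_davisWeight_inner hg hi]

theorem ofReal_sqrt_eq_rpow {t : ℝ} (ht : 0 ≤ t) :
    ENNReal.ofReal √t = ENNReal.ofReal t ^ (1 / 2 : ℝ) := by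
  rw [Real.sqrt_eq_rpow, ENNReal.ofReal_rpow_of_nonneg ht (by norm_num)]

theorem ofReal_norm_eq_rpow (v : EuclideanSpace ℝ ι) :
    ENNReal.ofReal ‖v‖ = (∑ a, ENNReal.ofReal (v a ^ 2)) ^ (1 / 2 : ℝ) := by
  rw [EuclideanSpace.norm_eq, ofReal_sqrt_eq_rpow (by positivity),
    ENNReal.ofReal_sum_of_nonneg fun _ _ => by positivity]
  simp

theorem ofReal_quadVar_le (g : ι → (Fin m → ℝ) → ℝ) (N : ℤ) (y : Fin m → ℝ) (j : ℕ) :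
    ENNReal.ofReal (quadVar (martPath g N y) j) ≤
      ∑ a, ∑' Q : DyadicCube m, ENNReal.ofReal (deltaQ Q (g a) y ^ 2) := by
  have hq : quadVar (martPath g N y) j = ∑ a, ∑ i ∈ Finset.range j,
      (Ek (N - i - 1) (g a) y - Ek (N - i) (g a) y) ^ 2 := by
    rw [Finset.sum_comm]
    refine Finset.sum_congr rfl fun i _ => ?_
    rw [EuclideanSpace.norm_sq_eq]
    simp only [martPath_sub, Real.norm_eq_abs, sq_abs]
  rw [hq, ENNReal.ofReal_sum_of_nonneg fun _ _ => Finset.sum_nonneg fun _ _ => sq_nonneg _]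
  refine Finset.sum_le_sum fun a _ => ?_
  rw [ENNReal.ofReal_sum_of_nonneg fun _ _ => sq_nonneg _]
  have hinj : Function.Injective fun i : ℕ => dyadicCubeOf (N - i) y := by
    intro i i' h
    have := congrArg DyadicCube.k h
    simpa [dyadicCubeOf] using this
  refine le_trans (le_of_eq ?_) ((ENNReal.sum_le_tsum (Finset.range j)).trans
    (ENNReal.tsum_comp_le_tsum_of_injective hinj
      fun Q => ENNReal.ofReal (deltaQ Q (g a) y ^ 2)))
  refine Finset.sum_congr rfl fun i _ => ?_
  simp only [deltaQ]
  rw [Set.indicator_of_mem ((mem_dyadicCubeSet_iff _ _).2 rfl)]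
  rfl

/-- The one-parameter inequality `‖g‖_{L¹} ≤ 8 ‖S g‖_{L¹}` for finite families of functions. -/
theorem lintegral_family_le_deltaQ (hm : 1 ≤ m) (hg : ∀ a, Measurable (g a))
    (hi : ∀ a, Integrable (g a)) :
    ∫⁻ y, (∑ a, ENNReal.ofReal (g a y ^ 2)) ^ (1 / 2 : ℝ) ≤
      8 * ∫⁻ y, (∑ a, ∑' Q : DyadicCube m, ENNReal.ofReal (deltaQ Q (g a) y ^ 2)) ^
        (1 / 2 : ℝ) := by
  have hbound (N : ℕ) : ∫⁻ y, ENNReal.ofReal ‖martPath g N y (2 * N)‖ ≤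
      8 * ∫⁻ y, (∑ a, ∑' Q : DyadicCube m, ENNReal.ofReal (deltaQ Q (g a) y ^ 2)) ^
        (1 / 2 : ℝ) := by
    rw [← ofReal_integral_eq_lintegral_ofReal (integrable_martPath hg hi _ _).norm
      (Eventually.of_forall fun _ => norm_nonneg _)]
    refine (ENNReal.ofReal_le_ofReal (integral_norm_martPath_le hg hi _ _)).trans ?_
    rw [ENNReal.ofReal_mul (by norm_num), ofReal_integral_eq_lintegral_ofReal
      (integrable_sqrt_quadVar_martPath hg hi _ _)
      (Eventually.of_forall fun _ => Real.sqrt_nonneg _), ENNReal.ofReal_ofNat]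
    refine mul_le_mul_right (lintegral_mono fun y => ?_) _
    rw [ofReal_sqrt_eq_rpow (quadVar_nonneg _ _)]
    exact ENNReal.rpow_le_rpow (ofReal_quadVar_le _ _ _ _) (by norm_num)
  have hlim : ∀ᵐ y, Tendsto (fun N : ℕ => ENNReal.ofReal ‖martPath g N y (2 * N)‖) atTop
      (nhds ((∑ a, ENNReal.ofReal (g a y ^ 2)) ^ (1 / 2 : ℝ))) := by
    filter_upwards [ae_all_iff.2 fun a => tendsto_Ek_atBot_generation (hi a)] with y hy
    rw [← ofReal_norm_eq_rpow (WithLp.toLp 2 fun a => g a y)]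
    refine ENNReal.tendsto_ofReal (Tendsto.norm ?_)
    refine ((PiLp.continuous_toLp 2 _).tendsto _).comp (tendsto_pi_nhds.2 fun a => ?_)
    have := (hy a).sub (tendsto_Ek_atTop_generation hm (hi a) y)
    rw [sub_zero] at this
    refine this.congr fun N => ?_
    congr 2
    push_cast
    ring
  calc ∫⁻ y, (∑ a, ENNReal.ofReal (g a y ^ 2)) ^ (1 / 2 : ℝ)
      = ∫⁻ y, liminf (fun N : ℕ => ENNReal.ofReal ‖martPath g N y (2 * N)‖) atTop :=
        lintegral_congr_ae (hlim.mono fun y hy => hy.liminf_eq.symm)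
    _ ≤ liminf (fun N : ℕ => ∫⁻ y, ENNReal.ofReal ‖martPath g N y (2 * N)‖) atTop :=
        lintegral_liminf_le fun N => (measurable_martPath hg _ _).norm.ennreal_ofReal
    _ ≤ _ := liminf_le_of_le (by isBoundedDefault) fun b hb =>
        let ⟨N, hN⟩ := hb.exists
        hN.trans (hbound N)

end oneParameter

section blocks

variable {d : ℕ} {n : Fin d → ℕ}

theorem lintegral_le_of_block (i : Fin d) {u v : ProductSpace n → ℝ≥0∞} (hu : Measurable u)
    (hv : Measurable v)
    (h : ∀ x, ∫⁻ y, u (Function.update x i y) ≤ ∫⁻ y, v (Function.update x i y)) :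
    ∫⁻ x, u x ≤ ∫⁻ x, v x := by
  rw [volume_pi]
  refine lintegral_le_of_lmarginal_le {i} hu hv fun x => ?_
  rw [lmarginal_singleton, lmarginal_singleton]
  exact h x

theorem measurable_block_lintegral (i : Fin d) {u : ProductSpace n → ℝ≥0∞} (hu : Measurable u) :
    Measurable fun x => ∫⁻ y, u (Function.update x i y) := by
  have := hu.lmarginal (fun i => (volume : Measure (Fin (n i) → ℝ))) (s := {i})
  simpa only [lmarginal_singleton] using this

theorem ae_block_lintegral_eq_zero (i : Fin d) {u : ProductSpace n → ℝ≥0∞} (hu : Measurable u)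
    (h : ∫⁻ x, u x = 0) : ∀ᵐ x, ∫⁻ y, u (Function.update x i y) = 0 := by
  have hB := measurable_block_lintegral i hu
  have hs : MeasurableSet {x : ProductSpace n | ∫⁻ y, u (Function.update x i y) ≠ 0} :=
    (hB (measurableSet_singleton 0)).compl
  rw [ae_iff, ← lintegral_indicator_one hs, ← nonpos_iff_eq_zero]
  calc _ ≤ ∫⁻ x, ∞ * u x := by
        refine lintegral_le_of_block i (measurable_one.indicator hs) (hu.const_mul _) fun x => ?_
        rw [lintegral_const_mul _ (by fun_prop)]
        by_cases hx : ∫⁻ y, u (Function.update x i y) = 0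
        · simp [Set.indicator, hx]
        · rw [ENNReal.top_mul hx]
          exact le_top
    _ ≤ 0 := by rw [lintegral_const_mul _ hu, h, mul_zero]

theorem ae_block_lintegral_lt_top (i : Fin d) {u : ProductSpace n → ℝ≥0∞} (hu : Measurable u)
    (h : ∫⁻ x, u x < ∞) : ∀ᵐ x, ∫⁻ y, u (Function.update x i y) < ∞ := by
  have hB := measurable_block_lintegral i hu
  set s := {x : ProductSpace n | ∫⁻ y, u (Function.update x i y) = ∞} with hs_def
  have hs : MeasurableSet s := hB (measurableSet_singleton ∞)
  have hmem (x y) : Function.update x i y ∈ s ↔ x ∈ s := by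
    simp [hs_def]
  have hu' := hu.indicator hs
  have hblock (x) (hx : x ∈ s) : ∫⁻ y, s.indicator u (Function.update x i y) = ∞ := by
    rw [← show ∫⁻ y, u (Function.update x i y) = ∞ from hx]
    exact lintegral_congr fun y => Set.indicator_of_mem ((hmem x y).2 hx) _
  have h2 : ∫⁻ x, 2 * s.indicator u x ≤ ∫⁻ x, s.indicator u x := by
    refine lintegral_le_of_block i (hu'.const_mul _) hu' fun x => ?_
    by_cases hx : x ∈ s
    · rw [hblock x hx]
      exact le_top
    · simp [Set.indicator, hmem, hx]
  rw [lintegral_const_mul _ hu', two_mul] at h2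
  have hfin : ∫⁻ x, s.indicator u x ≠ ∞ :=
    ((lintegral_mono fun x => Set.indicator_le_self _ _ x).trans_lt h).ne
  have h0 : ∫⁻ x, s.indicator u x = 0 := by
    rw [← nonpos_iff_eq_zero]
    exact (ENNReal.add_le_add_iff_left hfin).1 (by rwa [add_zero])
  filter_upwards [ae_block_lintegral_eq_zero i hu' h0] with x hx
  refine lt_top_iff_ne_top.2 fun hxs => ?_
  rw [hblock x hxs] at hx
  exact ENNReal.top_ne_zero hx

theorem lintegral_le_of_block_of_lt_top (i : Fin d) {u v w : ProductSpace n → ℝ≥0∞}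
    (hu : Measurable u) (hv : Measurable v) (hw : Measurable w) (hfin : ∫⁻ x, w x < ∞)
    (h : ∀ x, ∫⁻ y, w (Function.update x i y) < ∞ →
      ∫⁻ y, u (Function.update x i y) ≤ ∫⁻ y, v (Function.update x i y)) :
    ∫⁻ x, u x ≤ ∫⁻ x, v x := by
  set s := {x : ProductSpace n | ∫⁻ y, w (Function.update x i y) < ∞} with hs_def
  have hs : MeasurableSet s := measurable_block_lintegral i hw measurableSet_Iio
  have hmem (x y) : Function.update x i y ∈ s ↔ x ∈ s := by
    simp [hs_def]
  have hae : ∀ᵐ x, s.indicator u x = u x := by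
    filter_upwards [ae_block_lintegral_lt_top i hw hfin] with x hx
    exact Set.indicator_of_mem (show x ∈ s from hx) u
  rw [← lintegral_congr_ae hae]
  refine lintegral_le_of_block i (hu.indicator hs) hv fun x => ?_
  by_cases hx : x ∈ s
  · exact (lintegral_mono fun y => Set.indicator_le_self _ _ _).trans (h x hx)
  · simp [Set.indicator, hmem, hx]

theorem deltaBlock_update (i : Fin d) (c : DyadicCube (n i)) (f : ProductSpace n → ℝ)
    (x : ProductSpace n) (y : Fin (n i) → ℝ) :
    deltaBlock i c f (Function.update x i y) =
      deltaQ c (fun z => f (Function.update x i z)) y := by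
  simp [deltaBlock]

theorem measurable_deltaBlock (i : Fin d) (c : DyadicCube (n i)) {f : ProductSpace n → ℝ}
    (hf : Measurable f) : Measurable (deltaBlock i c f) := by
  have hE (k : ℤ) : Measurable fun x : ProductSpace n =>
      Ek k (fun y => f (Function.update x i y)) (x i) := by
    simp only [Ek_eq_integral]
    refine (StronglyMeasurable.integral_prod_right
      (f := fun (x : ProductSpace n) y => avgKernel k (x i) y * f (Function.update x i y))
      (Measurable.stronglyMeasurable ?_)).measurable
    refine Measurable.mul ?_ (hf.comp measurable_update')
    have hp : Measurable fun p : ProductSpace n × (Fin (n i) → ℝ) => (p.1 i, p.2) := by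
      fun_prop
    exact (measurable_avgKernel k).comp hp
  have hs : MeasurableSet {x : ProductSpace n | x i ∈ dyadicCubeSet c} :=
    measurable_pi_apply i (measurableSet_dyadicCubeSet c)
  exact ((hE (c.k - 1)).sub (hE c.k)).indicator hs

theorem integrable_deltaBlock (i : Fin d) (c : DyadicCube (n i)) {f : ProductSpace n → ℝ}
    (hf : Measurable f) (hi : Integrable f) : Integrable (deltaBlock i c f) := by
  have hm := measurable_deltaBlock i c hf
  refine ⟨hm.aestronglyMeasurable, ?_⟩
  have : ∫⁻ x, ‖deltaBlock i c f x‖ₑ ≤ ∫⁻ x, 2 * ‖f x‖ₑ := by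
    refine lintegral_le_of_block i hm.enorm (hf.enorm.const_mul _) fun x => ?_
    simp only [deltaBlock_update]
    have hx : Measurable fun y => f (Function.update x i y) := by fun_prop
    rw [lintegral_const_mul _ hx.enorm]
    exact lintegral_enorm_deltaQ_le hx c
  refine this.trans_lt ?_
  rw [lintegral_const_mul _ hf.enorm]
  exact ENNReal.mul_lt_top (by simp) hi.2

theorem deltaBlock_congr_ae (i : Fin d) (c : DyadicCube (n i)) {f g : ProductSpace n → ℝ}
    (h : f =ᵐ[volume] g) : deltaBlock i c f =ᵐ[volume] deltaBlock i c g := by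
  have hZ := measurableSet_toMeasurable (volume : Measure (ProductSpace n)) {x | ¬ f x = g x}
  have h0 : ∫⁻ x, (toMeasurable (volume : Measure (ProductSpace n))
      {x | ¬ f x = g x}).indicator 1 x = 0 := by
    rw [lintegral_indicator_one hZ, measure_toMeasurable]
    exact h
  filter_upwards [ae_block_lintegral_eq_zero i (measurable_one.indicator hZ) h0] with x hx
  have hm : Measurable fun y => (toMeasurable (volume : Measure (ProductSpace n))
      {x | ¬ f x = g x}).indicator (1 : ProductSpace n → ℝ≥0∞) (Function.update x i y) :=
    (measurable_one.indicator hZ).comp (measurable_update x)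
  rw [lintegral_eq_zero_iff hm] at hx
  have : (fun y => f (Function.update x i y)) =ᵐ[volume] fun y => g (Function.update x i y) := by
    filter_upwards [hx] with y hy
    by_contra hne
    have hy' : Function.update x i y ∈ toMeasurable (volume : Measure (ProductSpace n))
      {x | ¬ f x = g x} := subset_toMeasurable _ _ hne
    simp [Set.indicator_of_mem hy'] at hy
  rw [deltaBlock, deltaBlock, deltaQ_congr_ae this]

instance instCountableDyadicCube (m : ℕ) : Countable (DyadicCube m) :=
  Function.Injective.countable (f := fun c : DyadicCube m => (c.k, c.j)) fun c c' h => by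
    cases c; cases c'; simpa using h

/-- The one-parameter inequality in the block `i`, for finite families of functions. -/
theorem lintegral_finite_family_le_deltaBlock (i : Fin d) (hn : 1 ≤ n i) {ι : Type*} [Fintype ι]
    {f : ι → ProductSpace n → ℝ} (hf : ∀ a, Measurable (f a)) (hi : ∀ a, Integrable (f a)) :
    ∫⁻ x, (∑ a, ENNReal.ofReal (f a x ^ 2)) ^ (1 / 2 : ℝ) ≤
      8 * ∫⁻ x, (∑ a, ∑' Q : DyadicCube (n i), ENNReal.ofReal (deltaBlock i Q (f a) x ^ 2)) ^
        (1 / 2 : ℝ) := by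
  have hmu : Measurable fun x => (∑ a, ENNReal.ofReal (f a x ^ 2)) ^ (1 / 2 : ℝ) := by fun_prop
  have hmv : Measurable fun x => (∑ a, ∑' Q : DyadicCube (n i),
      ENNReal.ofReal (deltaBlock i Q (f a) x ^ 2)) ^ (1 / 2 : ℝ) := by
    refine Measurable.pow_const (Finset.measurable_sum _ fun a _ =>
      Measurable.tsum fun Q => ?_) _
    exact ((measurable_deltaBlock i Q (hf a)).pow_const 2).ennreal_ofReal
  have hmw : Measurable fun x => ∑ a, ‖f a x‖ₑ := by fun_prop
  rw [← lintegral_const_mul _ hmv]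
  refine lintegral_le_of_block_of_lt_top i hmu (hmv.const_mul _) hmw ?_ fun x hx => ?_
  · rw [lintegral_finsetSum _ fun a _ => (hf a).enorm]
    exact ENNReal.sum_lt_top.2 fun a _ => (hi a).2
  · have hsec (a) : Measurable fun y => f a (Function.update x i y) := by fun_prop
    rw [lintegral_finsetSum _ fun a _ => (hsec a).enorm] at hx
    rw [lintegral_const_mul _ (by exact hmv.comp (measurable_update x))]
    simp only [deltaBlock_update]
    exact lintegral_family_le_deltaQ hn hsec fun a =>
      ⟨(hsec a).aestronglyMeasurable, ENNReal.sum_lt_top.1 hx a (Finset.mem_univ a)⟩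

/-- The one-parameter inequality in the block `i`, for countable families of functions. -/
theorem lintegral_family_le_deltaBlock (i : Fin d) (hn : 1 ≤ n i) {ι : Type*} [Countable ι]
    {f : ι → ProductSpace n → ℝ} (hf : ∀ a, Measurable (f a)) (hi : ∀ a, Integrable (f a)) :
    ∫⁻ x, (∑' a, ENNReal.ofReal (f a x ^ 2)) ^ (1 / 2 : ℝ) ≤
      8 * ∫⁻ x, (∑' a, ∑' Q : DyadicCube (n i), ENNReal.ofReal (deltaBlock i Q (f a) x ^ 2)) ^
        (1 / 2 : ℝ) := by
  have hsup (x) : (∑' a, ENNReal.ofReal (f a x ^ 2)) ^ (1 / 2 : ℝ) =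
      ⨆ s : Finset ι, (∑ a ∈ s, ENNReal.ofReal (f a x ^ 2)) ^ (1 / 2 : ℝ) := by
    rw [ENNReal.tsum_eq_iSup_sum]
    exact (ENNReal.orderIsoRpow (1 / 2 : ℝ) (by norm_num)).map_iSup _
  simp only [hsup]
  rw [lintegral_iSup_directed]
  · refine iSup_le fun s => ?_
    have h := lintegral_finite_family_le_deltaBlock i hn (f := fun a : s => f a)
      (fun a => hf a) (fun a => hi a)
    have hsum (x) : ∑ a : s, ENNReal.ofReal (f a x ^ 2) = ∑ a ∈ s, ENNReal.ofReal (f a x ^ 2) :=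
      Finset.sum_coe_sort s fun a => ENNReal.ofReal (f a x ^ 2)
    simp only [hsum] at h
    refine h.trans (mul_le_mul_right (lintegral_mono fun x => ?_) _)
    refine ENNReal.rpow_le_rpow ?_ (by norm_num)
    rw [Finset.sum_coe_sort s fun a => ∑' Q : DyadicCube (n i),
      ENNReal.ofReal (deltaBlock i Q (f a) x ^ 2)]
    exact ENNReal.sum_le_tsum s
  · intro s
    fun_prop
  · refine Monotone.directed_le fun s t hst x => ?_
    exact ENNReal.rpow_le_rpow (Finset.sum_le_sum_of_subset hst) (by norm_num)

end blocks

section iteration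

variable {d : ℕ} {n : Fin d → ℕ}

/-- The iterated difference operator over the blocks in the list `l`. -/
noncomputable def deltaList (l : List (Fin d)) (R : DyadicRect n) (f : ProductSpace n → ℝ) :
    ProductSpace n → ℝ :=
  l.foldr (fun i g => deltaBlock i (R i) g) f

theorem deltaList_nil (R : DyadicRect n) (f : ProductSpace n → ℝ) : deltaList [] R f = f :=
  rfl

theorem deltaList_cons (i : Fin d) (l : List (Fin d)) (R : DyadicRect n)
    (f : ProductSpace n → ℝ) :
    deltaList (i :: l) R f = deltaBlock i (R i) (deltaList l R f) :=
  rfl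

theorem deltaList_update {i : Fin d} {l : List (Fin d)} (hi : i ∉ l) (R : DyadicRect n)
    (Q : DyadicCube (n i)) (f : ProductSpace n → ℝ) :
    deltaList l (Function.update R i Q) f = deltaList l R f := by
  induction l with
  | nil => rw [deltaList_nil, deltaList_nil]
  | cons j l ih =>
    rw [List.mem_cons, not_or] at hi
    rw [deltaList_cons, deltaList_cons, ih hi.2, Function.update_of_ne (Ne.symm hi.1)]

theorem measurable_deltaList (l : List (Fin d)) (R : DyadicRect n) {f : ProductSpace n → ℝ}
    (hf : Measurable f) : Measurable (deltaList l R f) := by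
  induction l with
  | nil => exact hf
  | cons i l ih => exact measurable_deltaBlock i _ ih

theorem integrable_deltaList (l : List (Fin d)) (R : DyadicRect n) {f : ProductSpace n → ℝ}
    (hf : Measurable f) (hi : Integrable f) : Integrable (deltaList l R f) := by
  induction l with
  | nil => exact hi
  | cons i l ih => exact integrable_deltaBlock i _ (measurable_deltaList l R hf) ih

theorem deltaList_congr_ae (l : List (Fin d)) (R : DyadicRect n) {f g : ProductSpace n → ℝ}
    (h : f =ᵐ[volume] g) : deltaList l R f =ᵐ[volume] deltaList l R g := by
  induction l with
  | nil => exact h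
  | cons i l ih => exact deltaBlock_congr_ae i _ ih

/-- Rectangles which agree with `R₀` in the blocks outside the list `l`. -/
abbrev RectsOver (R₀ : DyadicRect n) (l : List (Fin d)) : Type :=
  {R : DyadicRect n // ∀ i ∉ l, R i = R₀ i}

/-- Extend a rectangle by a cube in a further block. -/
def RectsOver.extend {R₀ : DyadicRect n} {l : List (Fin d)} (i : Fin d)
    (p : RectsOver R₀ l × DyadicCube (n i)) : RectsOver R₀ (i :: l) :=
  ⟨Function.update p.1.1 i p.2, fun j hj => by
    rw [List.mem_cons, not_or] at hj
    rw [Function.update_of_ne hj.1, p.1.2 j hj.2]⟩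

theorem RectsOver.extend_injective {R₀ : DyadicRect n} {l : List (Fin d)} {i : Fin d}
    (hi : i ∉ l) : Function.Injective (RectsOver.extend (R₀ := R₀) (l := l) i) := by
  rintro ⟨⟨R, hR⟩, Q⟩ ⟨⟨R', hR'⟩, Q'⟩ h
  have h' : Function.update R i Q = Function.update R' i Q' := congrArg Subtype.val h
  have hQ : Q = Q' := by simpa using congrFun h' i
  have hRR : R = R' := by
    ext1 j
    by_cases hj : j = i
    · subst hj
      rw [hR j hi, hR' j hi]
    · simpa [hj] using congrFun h' j
  subst hQ hRR
  rfl

theorem lintegral_le_deltaList (hn : ∀ i, 1 ≤ n i) (R₀ : DyadicRect n) {l : List (Fin d)}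
    (hl : l.Nodup) {f : ProductSpace n → ℝ} (hf : Measurable f) (hi : Integrable f) :
    ∫⁻ x, ENNReal.ofReal |f x| ≤ 8 ^ l.length *
      ∫⁻ x, (∑' R : RectsOver R₀ l, ENNReal.ofReal (deltaList l R.1 f x ^ 2)) ^ (1 / 2 : ℝ) := by
  induction l with
  | nil =>
    rw [List.length_nil, pow_zero, one_mul]
    refine lintegral_mono fun x => ?_
    rw [← Real.sqrt_sq_eq_abs, ofReal_sqrt_eq_rpow (sq_nonneg _)]
    refine ENNReal.rpow_le_rpow ?_ (by norm_num)
    exact ENNReal.le_tsum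
      (f := fun R : RectsOver R₀ [] => ENNReal.ofReal (deltaList [] R.1 f x ^ 2))
      ⟨R₀, fun _ _ => rfl⟩
  | cons i l ih =>
    rw [List.nodup_cons] at hl
    refine (ih hl.2).trans ?_
    rw [List.length_cons, pow_succ, mul_assoc]
    refine mul_le_mul_right ?_ _
    refine (lintegral_family_le_deltaBlock i (hn i)
      (f := fun R : RectsOver R₀ l => deltaList l R.1 f)
      (fun R => measurable_deltaList l R.1 hf)
      (fun R => integrable_deltaList l R.1 hf hi)).trans ?_
    refine mul_le_mul_right (lintegral_mono fun x => ENNReal.rpow_le_rpow ?_ (by norm_num)) _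
    rw [← ENNReal.tsum_prod]
    refine le_trans (le_of_eq (tsum_congr fun p => ?_)) (ENNReal.tsum_comp_le_tsum_of_injective
      (RectsOver.extend_injective hl.1)
      fun R => ENNReal.ofReal (deltaList (i :: l) R.1 f x ^ 2))
    rw [deltaList_cons, RectsOver.extend, deltaList_update hl.1]
    simp only [Function.update_self]

theorem squareFn_congr_ae {f g : ProductSpace n → ℝ} (h : f =ᵐ[volume] g) :
    squareFn f =ᵐ[volume] squareFn g := by
  filter_upwards [ae_all_iff.2 fun R : DyadicRect n =>
    deltaList_congr_ae (List.finRange d) R h] with x hx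
  rw [squareFn, squareFn]
  congr 1
  exact tsum_congr fun R => congrArg (fun t : ℝ => ENNReal.ofReal (t ^ 2)) (hx R)

theorem lintegral_le_H1Norm (hn : ∀ i, 1 ≤ n i) {f : ProductSpace n → ℝ} (hf : Measurable f)
    (hi : Integrable f) : ∫⁻ x, ENNReal.ofReal |f x| ≤ 8 ^ d * H1Norm f := by
  have h := lintegral_le_deltaList hn (fun _ => ⟨0, 0⟩) (List.nodup_finRange d) hf hi
  rw [List.length_finRange] at h
  refine h.trans (mul_le_mul_right (lintegral_mono fun x => ?_) _)
  refine ENNReal.rpow_le_rpow ?_ (by norm_num)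
  exact ENNReal.tsum_comp_le_tsum_of_injective Subtype.val_injective
    fun R : DyadicRect n => ENNReal.ofReal (deltaR R f x ^ 2)

end iteration

/-- the `L¹` norm is controlled by the dyadic product `H¹` norm:
`‖f‖_{L¹} ≤ C‖S f‖_{L¹}` for every `f ∈ L¹(ℝⁿ)`. -/
theorem statement14 {d : ℕ} (hd : 1 ≤ d) (n : Fin d → ℕ) (hn : ∀ i, 1 ≤ n i) :
    ∃ C > (0 : ℝ), ∀ f : ProductSpace n → ℝ, Integrable f →
      ∫⁻ x, ENNReal.ofReal |f x| ≤ ENNReal.ofReal C * H1Norm f := by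
  refine ⟨8 ^ d, by positivity, fun f hf => ?_⟩
  obtain ⟨g, hg, hfg⟩ := hf.aestronglyMeasurable
  have h := lintegral_le_H1Norm hn hg.measurable (hf.congr hfg)
  have habs : ∫⁻ x, ENNReal.ofReal |f x| = ∫⁻ x, ENNReal.ofReal |g x| :=
    lintegral_congr_ae (hfg.mono fun x hx => by simp only [hx])
  have hH : H1Norm f = H1Norm g := lintegral_congr_ae (squareFn_congr_ae hfg)
  rw [habs, hH, ENNReal.ofReal_pow (by norm_num), ENNReal.ofReal_ofNat]
  exact h
end
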